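/- arXiv:1308.4881 — 3 statements merged into one kernel-verified Lean document; each statement's English description precedes it below -/
import Mathlib

section
/- Let 0 < p < ∞ and −2 ≤ α ≤ 0, and let f be a non-constant analytic function on the unit disk 𝔻. Then the area integral mean M_{p,α}(f,r) is logarithmically convex on (0,1); that is, the function t ↦ log M_{p,α}(f, e^t) is convex on (−∞, 0). -/
open Real Set MeasureTheory

lemma aux_log_submean {F : ℂ → ℂ} {c : ℂ} {R : ℝ} (hR : 0 < R)
    (hF : AnalyticOnNhd ℂ F (Metric.closedBall c R)) (hc : F c ≠ 0) :
    Real.log ‖F c‖ ≤ circleAverage (fun z => Real.log ‖F z‖) c R := by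
  have hR' : |R| = R := abs_of_pos hR
  have hm : MeromorphicOn F (Metric.closedBall c |R|) := by
    rw [hR']; exact hF.meromorphicOn
  rw [MeromorphicOn.circleAverage_log_norm hR.ne' hm, hR']
  have hcA : AnalyticAt ℂ F c := hF c (Metric.mem_closedBall_self hR.le)
  rw [hcA.meromorphicTrailingCoeffAt_of_ne_zero hc]
  have hnn := MeromorphicOn.AnalyticOnNhd.divisor_nonneg hF
  have hd : MeromorphicOn.divisor F (Metric.closedBall c R) c = 0 := by
    rw [MeromorphicOn.divisor_apply hF.meromorphicOn (Metric.mem_closedBall_self hR.le)]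
    rw [hcA.meromorphicOrderAt_eq, hcA.analyticOrderAt_eq_zero.2 hc]
    simp
  rw [hd]
  have : 0 ≤ ∑ᶠ u, (MeromorphicOn.divisor F (Metric.closedBall c R) u : ℝ) * Real.log (R * ‖c - u‖⁻¹) := by
    apply finsum_nonneg
    intro u
    by_cases hu : u ∈ Metric.closedBall c R
    · apply mul_nonneg
      · exact_mod_cast hnn u
      · by_cases h0 : ‖c - u‖ = 0
        · simp [h0]
        · apply Real.log_nonneg
          have h1 : 0 < ‖c - u‖ := lt_of_le_of_ne (norm_nonneg _) (Ne.symm h0)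
          rw [← div_eq_mul_inv, le_div_iff₀ h1, one_mul, ← dist_eq_norm, dist_comm]
          exact hu
    · rw [Function.locallyFinsuppWithin.apply_eq_zero_of_notMem _ hu]; simp
  simp only [Int.cast_zero, zero_mul, add_zero]
  linarith

lemma aux_pow_submean {F : ℂ → ℂ} {c : ℂ} {R p : ℝ} (hR : 0 < R) (hp : 0 < p)
    (hF : AnalyticOnNhd ℂ F (Metric.closedBall c R)) :
    ‖F c‖ ^ p ≤ circleAverage (fun z => ‖F z‖ ^ p) c R := by
  have hR' : |R| = R := abs_of_pos hR
  by_cases hc : F c = 0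
  · rw [hc, norm_zero, Real.zero_rpow hp.ne']
    exact circleAverage_nonneg_of_nonneg (fun x _ => Real.rpow_nonneg (norm_nonneg _) _)
  have hcod : F ⁻¹' {0}ᶜ ∈ Filter.codiscreteWithin (Metric.closedBall c R) :=
    hF.preimage_zero_mem_codiscreteWithin hc (Metric.mem_closedBall_self hR.le)
      ((convex_closedBall c R).isConnected ⟨c, Metric.mem_closedBall_self hR.le⟩)
  have hcod2 : F ⁻¹' {0}ᶜ ∈ Filter.codiscreteWithin (Metric.sphere c |R|) := by
    rw [hR']
    exact Filter.codiscreteWithin_mono Metric.sphere_subset_closedBall hcod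
  have heq : (fun z => Real.exp (p * Real.log ‖F z‖)) =ᶠ[Filter.codiscreteWithin (Metric.sphere c |R|)]
      (fun z => ‖F z‖ ^ p) := by
    filter_upwards [hcod2] with z hz
    have : 0 < ‖F z‖ := norm_pos_iff.2 (by simpa using hz)
    rw [Real.rpow_def_of_pos this, mul_comm]
  have hcont : ContinuousOn (fun z => ‖F z‖ ^ p) (Metric.sphere c R) := by
    apply ContinuousOn.rpow_const
    · exact (hF.continuousOn.mono Metric.sphere_subset_closedBall).norm
    · intro x _; right; exact hp.le
  have hint : CircleIntegrable (fun z => ‖F z‖ ^ p) c R := hcont.circleIntegrable hR.le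
  have hint2 : CircleIntegrable (fun z => Real.exp (p * Real.log ‖F z‖)) c R :=
    hint.congr_codiscreteWithin heq.symm
  have hint3 : CircleIntegrable (fun z => Real.log ‖F z‖) c R :=
    MeromorphicOn.circleIntegrable_log_norm
      (by rw [hR']; exact hF.meromorphicOn.mono_set Metric.sphere_subset_closedBall)
  rw [← circleAverage_congr_codiscreteWithin heq hR.ne']
  have h1 : ‖F c‖ ^ p = Real.exp (p * Real.log ‖F c‖) := by
    rw [Real.rpow_def_of_pos (norm_pos_iff.2 hc), mul_comm]
  rw [h1]
  have h2 := aux_log_submean hR hF hc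
  have h3 : circleAverage (fun z => p * Real.log ‖F z‖) c R = p * circleAverage (fun z => Real.log ‖F z‖) c R := by
    simpa using circleAverage_fun_smul (a := p) (f := fun z => Real.log ‖F z‖) (c := c) (R := R)
  calc Real.exp (p * Real.log ‖F c‖) ≤ Real.exp (circleAverage (fun z => p * Real.log ‖F z‖) c R) := by
        rw [h3]; gcongr
    _ ≤ _ := by
        rw [circleAverage_eq_intervalAverage, circleAverage_eq_intervalAverage]
        have hle : (0:ℝ) ≤ 2 * π := by positivity
        have : IsFiniteMeasure (volume.restrict (uIoc 0 (2 * π))) := by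
          rw [uIoc_of_le hle]; infer_instance
        have : NeZero (volume.restrict (uIoc 0 (2 * π))) := ⟨by
          rw [uIoc_of_le hle]; simp [Measure.restrict_eq_zero, pi_pos]⟩
        refine convexOn_exp.map_average_le continuousOn_exp isClosed_univ (by simp) ?_ ?_
        · rw [Set.uIoc_of_le hle]
          exact (hint3.const_mul p).1
        · rw [Set.uIoc_of_le hle]
          exact hint2.1

lemma aux_max_principle {ψ : ℝ → ℝ} {a b C : ℝ} (hab : a ≤ b) (hψ : ContinuousOn ψ (Icc a b))
    (hsub : ∀ t ρ : ℝ, 0 < ρ → a ≤ t - ρ → t + ρ ≤ b →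
      2 * π * ψ t ≤ ∫ θ in (0:ℝ)..2 * π, ψ (t + ρ * Real.cos θ))
    (ha : ψ a ≤ C) (hb : ψ b ≤ C) : ∀ t ∈ Icc a b, ψ t ≤ C := by
  obtain ⟨tm, htm, hmax⟩ := isCompact_Icc.exists_isMaxOn (nonempty_Icc.2 hab) hψ
  by_contra! hcon
  obtain ⟨t1, ht1, hC⟩ := hcon
  have hM : C < ψ tm := lt_of_lt_of_le hC (hmax ht1)
  have hScomp : IsCompact (Icc a b ∩ ψ ⁻¹' {ψ tm}) :=
    isCompact_Icc.of_isClosed_subset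
      (hψ.preimage_isClosed_of_isClosed isClosed_Icc isClosed_singleton) inter_subset_left
  obtain ⟨t0, ht0⟩ := hScomp.exists_isLeast ⟨tm, htm, rfl⟩
  obtain ⟨⟨ht0m, ht0e⟩, hleast⟩ := ht0
  have ht0e' : ψ t0 = ψ tm := ht0e
  have h0a : a < t0 := by
    rcases eq_or_lt_of_le ht0m.1 with h | h
    · rw [← h] at ht0e'; linarith
    · exact h
  have h0b : t0 < b := by
    rcases eq_or_lt_of_le ht0m.2 with h | h
    · rw [h] at ht0e'; linarith
    · exact h
  set ρ := min (t0 - a) (b - t0) with hρdef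
  have hρ : 0 < ρ := lt_min (by linarith) (by linarith)
  have hρ1 : ρ ≤ t0 - a := min_le_left _ _
  have hρ2 : ρ ≤ b - t0 := min_le_right _ _
  have hmem : ∀ θ : ℝ, t0 + ρ * Real.cos θ ∈ Icc a b := by
    intro θ
    have h1 := Real.neg_one_le_cos θ
    have h2 := Real.cos_le_one θ
    constructor <;> nlinarith
  have key := hsub t0 ρ hρ (by linarith) (by linarith)
  have hlt : ∫ θ in (0:ℝ)..2 * π, ψ (t0 + ρ * Real.cos θ) < ∫ θ in (0:ℝ)..2 * π, ψ tm := by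
    apply intervalIntegral.integral_lt_integral_of_continuousOn_of_le_of_exists_lt
    · positivity
    · apply ContinuousOn.comp hψ
      · fun_prop
      · intro θ _; exact hmem θ
    · fun_prop
    · intro θ _; exact hmax (hmem θ)
    · refine ⟨π, ⟨pi_pos.le, by linarith [pi_pos]⟩, ?_⟩
      refine lt_of_le_of_ne (hmax (hmem π)) ?_
      intro h
      have := hleast ⟨hmem π, h⟩
      rw [Real.cos_pi] at this
      linarith
  rw [intervalIntegral.integral_const, smul_eq_mul, sub_zero] at hlt
  rw [ht0e'] at key
  linarith

lemma aux_submean_mean {f : ℂ → ℂ} (hf : DifferentiableOn ℂ f (Metric.ball 0 1)) {p : ℝ} (hp : 0 < p)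
    (l : ℝ) {t ρ : ℝ} (hρ : 0 < ρ) (ht : t + ρ < 0) :
    2 * π * (Real.exp (l * t) * ∫ s in (0:ℝ)..2 * π, ‖f (circleMap 0 (Real.exp t) s)‖ ^ p) ≤
      ∫ θ in (0:ℝ)..2 * π, (Real.exp (l * (t + ρ * Real.cos θ)) *
        ∫ s in (0:ℝ)..2 * π, ‖f (circleMap 0 (Real.exp (t + ρ * Real.cos θ)) s)‖ ^ p) := by
  set F : ℂ → ℂ := fun w => f (Complex.exp w) * Complex.exp ((l / p : ℝ) * w) with hFdef
  have hopen : IsOpen {w : ℂ | w.re < 0} := isOpen_lt Complex.continuous_re continuous_const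
  have hFd : DifferentiableOn ℂ F {w : ℂ | w.re < 0} := by
    apply DifferentiableOn.mul
    · apply hf.comp (Complex.differentiable_exp.differentiableOn)
      intro w hw
      simp only [Metric.mem_ball, dist_zero_right, Complex.norm_exp]
      exact by simpa using hw
    · fun_prop
  have hFa : AnalyticOnNhd ℂ F {w : ℂ | w.re < 0} := hFd.analyticOnNhd hopen
  have hG : ∀ t s : ℝ, ‖F (t + s * Complex.I)‖ ^ p =
      Real.exp (l * t) * ‖f (circleMap 0 (Real.exp t) s)‖ ^ p := by
    intro t s
    simp only [hFdef, norm_mul]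
    rw [Real.mul_rpow (norm_nonneg _) (norm_nonneg _), Complex.norm_exp, mul_comm]
    congr 1
    · rw [← Real.exp_mul]
      congr 1
      simp
      field_simp
    · rw [Complex.exp_add]
      simp [circleMap]
  have hcont : ContinuousOn (fun w => ‖F w‖ ^ p) {w : ℂ | w.re < 0} :=
    hFd.continuousOn.norm.rpow_const (fun _ _ => Or.inr hp.le)
  have hcm : ∀ s θ : ℝ, circleMap ((t:ℂ) + s * Complex.I) ρ θ =
      ((t + ρ * Real.cos θ : ℝ) : ℂ) + ((s + ρ * Real.sin θ : ℝ) : ℂ) * Complex.I := by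
    intro s θ
    simp only [circleMap, Complex.exp_mul_I]
    push_cast
    ring
  have hre : ∀ s θ : ℝ, (circleMap ((t:ℂ) + s * Complex.I) ρ θ) ∈ {w : ℂ | w.re < 0} := by
    intro s θ
    rw [hcm]
    change (_ : ℂ).re < 0
    simp only [Complex.add_re, Complex.ofReal_re, Complex.mul_re, Complex.I_re, Complex.I_im, Complex.ofReal_im, mul_zero, zero_mul, sub_zero, add_zero]
    nlinarith [Real.cos_le_one θ]
  have hjoint : Continuous (fun q : ℝ × ℝ => ‖F (circleMap ((t:ℂ) + q.1 * Complex.I) ρ q.2)‖ ^ p) := by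
    apply hcont.comp_continuous (f := fun q : ℝ × ℝ => circleMap ((t:ℂ) + q.1 * Complex.I) ρ q.2)
    · unfold circleMap; fun_prop
    · intro q; exact hre _ _
  have hpt : ∀ s : ℝ, 2 * π * (Real.exp (l * t) * ‖f (circleMap 0 (Real.exp t) s)‖ ^ p) ≤
      ∫ θ in (0:ℝ)..2 * π, ‖F (circleMap ((t:ℂ) + s * Complex.I) ρ θ)‖ ^ p := by
    intro s
    have h := aux_pow_submean (c := (t:ℂ) + s * Complex.I) hρ hp (hFa.mono (s := Metric.closedBall ((t:ℂ) + s * Complex.I) ρ) (by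
      intro w hw
      have h1 : ‖w - (t + s * Complex.I)‖ ≤ ρ := by simpa [dist_eq_norm] using hw
      have h2 := (Complex.abs_re_le_norm _).trans h1
      have h3 := (abs_le.1 h2).2
      simp at h3
      change w.re < 0
      linarith))
    rw [hG, circleAverage_def, smul_eq_mul] at h
    have hpi : 0 < 2 * π := by positivity
    rw [inv_mul_eq_div, le_div_iff₀ hpi] at h
    linarith
  have hct : Continuous (fun s : ℝ => ‖F (t + s * Complex.I)‖ ^ p) := by
    apply hcont.comp_continuous (f := fun s : ℝ => (t : ℂ) + s * Complex.I)
    · fun_prop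
    · intro s; simp; linarith
  calc 2 * π * (Real.exp (l * t) * ∫ s in (0:ℝ)..2 * π, ‖f (circleMap 0 (Real.exp t) s)‖ ^ p)
      = ∫ s in (0:ℝ)..2 * π, 2 * π * (Real.exp (l * t) * ‖f (circleMap 0 (Real.exp t) s)‖ ^ p) := by
        rw [intervalIntegral.integral_const_mul, intervalIntegral.integral_const_mul]
    _ ≤ ∫ s in (0:ℝ)..2 * π, ∫ θ in (0:ℝ)..2 * π, ‖F (circleMap ((t:ℂ) + s * Complex.I) ρ θ)‖ ^ p := by
        apply intervalIntegral.integral_mono_on (by positivity)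
        · simp_rw [← hG]
          exact (hct.const_mul _).intervalIntegrable _ _
        · apply Continuous.intervalIntegrable
          exact intervalIntegral.continuous_parametric_intervalIntegral_of_continuous' (f := fun s θ : ℝ => ‖F (circleMap ((t:ℂ) + s * Complex.I) ρ θ)‖ ^ p) hjoint _ _
        · intro s _; exact hpt s
    _ = ∫ θ in (0:ℝ)..2 * π, ∫ s in (0:ℝ)..2 * π, ‖F (circleMap ((t:ℂ) + s * Complex.I) ρ θ)‖ ^ p := by
        apply intervalIntegral_intervalIntegral_swap
        exact (hjoint.continuousOn.integrableOn_compact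
          (isCompact_uIcc.prod isCompact_uIcc)).mono_set
          (prod_mono uIoc_subset_uIcc uIoc_subset_uIcc)
    _ = _ := by
        apply intervalIntegral.integral_congr
        intro θ _
        simp only
        rw [← intervalIntegral.integral_const_mul]
        simp_rw [hcm, hG]
        rw [intervalIntegral.integral_comp_add_right (fun s => Real.exp (l * (t + ρ * Real.cos θ)) * ‖f (circleMap 0 (Real.exp (t + ρ * Real.cos θ)) s)‖ ^ p)]
        have hper : Function.Periodic (fun s => Real.exp (l * (t + ρ * Real.cos θ)) * ‖f (circleMap 0 (Real.exp (t + ρ * Real.cos θ)) s)‖ ^ p) (2 * π) := by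
          intro s
          simp only [periodic_circleMap _ _ s]
        have := hper.intervalIntegral_add_eq (ρ * Real.sin θ) 0
        simpa [add_comm] using this

lemma aux_mean_continuousOn {f : ℂ → ℂ} (hf : DifferentiableOn ℂ f (Metric.ball 0 1)) {p : ℝ} (hp : 0 < p) :
    ContinuousOn (fun r : ℝ => ∫ s in (0:ℝ)..2 * π, ‖f (circleMap 0 r s)‖ ^ p) (Ioo (-1) 1) := by
  rw [continuousOn_iff_continuous_domRestrict]
  apply intervalIntegral.continuous_parametric_intervalIntegral_of_continuous'
    (f := fun (r : Ioo (-1:ℝ) 1) s => ‖f (circleMap 0 r s)‖ ^ p)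
  have hcont : ContinuousOn (fun w => ‖f w‖ ^ p) (Metric.ball 0 1) :=
    hf.continuousOn.norm.rpow_const (fun _ _ => Or.inr hp.le)
  apply hcont.comp_continuous (f := fun q : Ioo (-1:ℝ) 1 × ℝ => circleMap 0 q.1 q.2)
  · unfold circleMap; fun_prop
  · intro q
    simp
    exact abs_lt.2 q.1.2

lemma aux_hardy {f : ℂ → ℂ} (hf : DifferentiableOn ℂ f (Metric.ball 0 1)) {p : ℝ} (hp : 0 < p)
    (hpos : ∀ t < 0, 0 < ∫ s in (0:ℝ)..2 * π, ‖f (circleMap 0 (Real.exp t) s)‖ ^ p) :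
    ConvexOn ℝ (Iio (0:ℝ)) (fun t => Real.log (∫ s in (0:ℝ)..2 * π, ‖f (circleMap 0 (Real.exp t) s)‖ ^ p)) := by
  set N : ℝ → ℝ := fun t => ∫ s in (0:ℝ)..2 * π, ‖f (circleMap 0 (Real.exp t) s)‖ ^ p with hN
  have hNc : ContinuousOn N (Iio 0) := by
    apply (aux_mean_continuousOn hf hp).comp (Real.continuous_exp.continuousOn)
    intro t ht
    exact ⟨by linarith [Real.exp_pos t], by simpa using ht⟩
  apply LinearOrder.convexOn_of_lt (convex_Iio 0)
  intro a ha b hb hab μ ν hμ hν hμν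
  have ha' : a < 0 := ha
  have hb' : b < 0 := hb
  set l : ℝ := (Real.log (N a) - Real.log (N b)) / (b - a) with hl
  have hl' : l * (b - a) = Real.log (N a) - Real.log (N b) := by
    rw [hl, div_mul_cancel₀]; linarith
  set ψ : ℝ → ℝ := fun t => Real.exp (l * t) * N t with hψ
  have hmem : μ * a + ν * b ∈ Icc a b := by
    have : ν = 1 - μ := by linarith
    subst this
    constructor <;> nlinarith
  have h0 : ∀ t < 0, ψ t = Real.exp (l * t + Real.log (N t)) := by
    intro t ht
    rw [Real.exp_add, Real.exp_log (hpos t ht)]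
  have hcl := aux_max_principle (ψ := ψ) (C := ψ a) hab.le
    (by
      apply ContinuousOn.mul (by fun_prop)
      exact hNc.mono (fun t ht => lt_of_le_of_lt ht.2 hb'))
    (fun t ρ hρ h1 h2 => aux_submean_mean hf hp l hρ (by linarith)) le_rfl
    (by
      rw [h0 a ha', h0 b hb']
      apply le_of_eq; congr 1; linarith) _ hmem
  rw [h0 a ha', h0 _ (lt_of_le_of_lt hmem.2 hb'), Real.exp_le_exp] at hcl
  simp only [smul_eq_mul]
  change Real.log (N (μ * a + ν * b)) ≤ μ * Real.log (N a) + ν * Real.log (N b)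
  have : μ = 1 - ν := by linarith
  subst this
  linear_combination hcl - ν * hl'

lemma aux_nonneg_of_deriv {y y' : ℝ → ℝ} (hy : ∀ t < 0, HasDerivAt y (y' t) t)
    (hy' : ∀ t < 0, 0 ≤ y' t) (hlim : Filter.Tendsto y Filter.atBot (nhds 0)) :
    ∀ t < 0, 0 ≤ y t := by
  have hmono : MonotoneOn y (Iio 0) := by
    apply monotoneOn_of_deriv_nonneg (convex_Iio 0)
    · exact fun t ht => (hy t ht).continuousAt.continuousWithinAt
    · rw [interior_Iio]
      exact fun t ht => (hy t ht).differentiableAt.differentiableWithinAt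
    · rw [interior_Iio]
      intro t ht
      rw [(hy t ht).deriv]; exact hy' t ht
  intro t ht
  apply le_of_tendsto hlim
  filter_upwards [Filter.eventually_le_atBot t] with s hs
  exact hmono (lt_of_le_of_lt hs ht) ht hs

lemma aux_ode_core {c m : ℝ} (hc0 : 0 ≤ c) (hc2 : c ≤ 2) (hm : 0 ≤ m) {q K φ φm : ℝ → ℝ}
    (hq : ∀ t < 0, HasDerivAt q (2 * q t * (1 + q t)) t) (hq0 : ∀ t < 0, 0 < q t)
    (hql : Filter.Tendsto q Filter.atBot (nhds 0))
    (hK : ∀ t < 0, HasDerivAt K (K t * (2 + 2 * c * q t)) t) (hK0 : ∀ t < 0, 0 < K t)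
    (hKl : Filter.Tendsto K Filter.atBot (nhds 0))
    (hφ : ∀ t < 0, HasDerivAt φ (K t) t) (hφ0 : ∀ t < 0, 0 < φ t)
    (hφl : Filter.Tendsto φ Filter.atBot (nhds 0))
    (hφm : ∀ t < 0, HasDerivAt φm (Real.exp (m * t) * K t) t) (hφm0 : ∀ t < 0, 0 < φm t)
    (hφml : Filter.Tendsto φm Filter.atBot (nhds 0)) :
    ∀ t < 0, K t / φ t ≤ Real.exp (m * t) * K t / φm t ∧
      K t / φ t * (2 + 2 * c * q t - K t / φ t) ≤
      Real.exp (m * t) * K t / φm t * (2 + 2 * c * q t + m - Real.exp (m * t) * K t / φm t) := by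
  set A : ℝ → ℝ := fun t => 2 + 2 * c * q t with hA
  set A1 : ℝ → ℝ := fun t => 4 * c * q t * (1 + q t) with hA1
  set P : ℝ → ℝ := fun t => Real.exp (m * t) * K t with hP
  have hA1nn : ∀ t < 0, 0 ≤ A1 t := fun t ht => by
    have := hq0 t ht
    simp only [hA1]; positivity
  have hA2 : ∀ t < 0, 2 ≤ A t := fun t ht => by
    have h1 := hq0 t ht
    have : 0 ≤ 2 * c * q t := by positivity
    simp only [hA]; linarith
  have hAd : ∀ t < 0, HasDerivAt A (A1 t) t := fun t ht => by
    refine (((hq t ht).const_mul (2 * c)).const_add 2).congr_deriv ?_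
    simp only [hA1]; ring
  have hAl : Filter.Tendsto A Filter.atBot (nhds 2) := by
    have := (hql.const_mul (2 * c)).const_add 2
    simpa using this
  have hP0 : ∀ t < 0, 0 < P t := fun t ht => mul_pos (Real.exp_pos _) (hK0 t ht)
  have hexp : ∀ t : ℝ, HasDerivAt (fun t => Real.exp (m * t)) (m * Real.exp (m * t)) t := fun t => by
    have := ((hasDerivAt_id t).const_mul m).exp
    simpa [mul_comm] using this
  have hPd : ∀ t < 0, HasDerivAt P (P t * (A t + m)) t := fun t ht => by
    refine ((hexp t).mul (hK t ht)).congr_deriv ?_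
    simp only [hP, hA]; ring
  have hexp1 : ∀ t < 0, Real.exp (m * t) ≤ 1 := fun t ht => by
    rw [Real.exp_le_one_iff]; nlinarith
  have hPl : Filter.Tendsto P Filter.atBot (nhds 0) := by
    apply squeeze_zero' _ _ hKl
    · filter_upwards [Filter.eventually_lt_atBot 0] with t ht using (hP0 t ht).le
    · filter_upwards [Filter.eventually_lt_atBot 0] with t ht
      have := hexp1 t ht
      have := hK0 t ht
      simp only [hP]; nlinarith
  -- first order bounds
  have b1 : ∀ t < 0, 0 ≤ K t - φ t := by
    apply aux_nonneg_of_deriv (fun t ht => (hK t ht).sub (hφ t ht))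
    · intro t ht
      have h1 := hK0 t ht
      have h2 := hA2 t ht
      simp only [hA] at h2
      nlinarith
    · have hl := hKl.sub hφl
      simp only [zero_mul, sub_zero] at hl
      exact hl
  have b2 : ∀ t < 0, 0 ≤ P t - φm t := by
    apply aux_nonneg_of_deriv (fun t ht => (hPd t ht).sub (hφm t ht))
    · intro t ht
      have h1 := hP0 t ht
      have h2 := hA2 t ht
      change 0 ≤ P t * (A t + m) - P t
      nlinarith
    · have hl := hPl.sub hφml
      simp only [zero_mul, sub_zero] at hl
      exact hl
  have b3 : ∀ t < 0, 0 ≤ φ t * A t - K t := by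
    apply aux_nonneg_of_deriv (fun t ht => ((hφ t ht).mul (hAd t ht)).sub (hK t ht))
    · intro t ht
      have h1 := mul_nonneg (hφ0 t ht).le (hA1nn t ht)
      simp only [hA] at *
      linarith
    · have hl := (hφl.mul hAl).sub hKl
      simp only [zero_mul, sub_zero] at hl
      exact hl
  have b4 : ∀ t < 0, 0 ≤ φm t * (A t + m) - P t := by
    apply aux_nonneg_of_deriv (fun t ht => ((hφm t ht).mul ((hAd t ht).add_const m)).sub (hPd t ht))
    · intro t ht
      have h1 := mul_nonneg (hφm0 t ht).le (hA1nn t ht)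
      change 0 ≤ P t * (A t + m) + φm t * A1 t - P t * (A t + m)
      linarith
    · have hl := (hφml.mul (hAl.add_const m)).sub hPl
      simp only [zero_mul, sub_zero] at hl
      exact hl
  have b5 : ∀ t < 0, 0 ≤ Real.exp (m * t) * φ t - φm t := by
    apply aux_nonneg_of_deriv (fun t ht => ((hexp t).mul (hφ t ht)).sub (hφm t ht))
    · intro t ht
      have h1 := hφ0 t ht
      have : 0 ≤ m * Real.exp (m * t) * φ t := by positivity
      linarith
    · have h1 : Filter.Tendsto (fun t => Real.exp (m * t) * φ t) Filter.atBot (nhds 0) := by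
        apply squeeze_zero' _ _ hφl
        · filter_upwards [Filter.eventually_lt_atBot 0] with t ht
          exact mul_nonneg (Real.exp_pos _).le (hφ0 t ht).le
        · filter_upwards [Filter.eventually_lt_atBot 0] with t ht
          have := hexp1 t ht
          have := hφ0 t ht
          nlinarith
      have hl := h1.sub hφml
      simp only [sub_zero] at hl
      exact hl
  set w : ℝ → ℝ := fun t => K t / φ t with hw
  set u : ℝ → ℝ := fun t => P t / φm t with hu
  have hw1 : ∀ t < 0, 1 ≤ w t := fun t ht => by
    simp only [hw]; rw [le_div_iff₀ (hφ0 t ht)]; linarith [b1 t ht]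
  have hu1 : ∀ t < 0, 1 ≤ u t := fun t ht => by
    simp only [hu]; rw [le_div_iff₀ (hφm0 t ht)]; linarith [b2 t ht]
  have hwA : ∀ t < 0, w t ≤ A t := fun t ht => by
    simp only [hw]; rw [div_le_iff₀ (hφ0 t ht)]; linarith [b3 t ht]
  have huA : ∀ t < 0, u t ≤ A t + m := fun t ht => by
    simp only [hu]; rw [div_le_iff₀ (hφm0 t ht)]; linarith [b4 t ht]
  have hwu : ∀ t < 0, w t ≤ u t := fun t ht => by
    simp only [hw, hu, hP]
    rw [div_le_div_iff₀ (hφ0 t ht) (hφm0 t ht)]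
    nlinarith [b5 t ht, hK0 t ht]
  have hwd : ∀ t < 0, HasDerivAt w (w t * (A t - w t)) t := fun t ht => by
    have h1 := (hφ0 t ht).ne'
    refine ((hK t ht).div (hφ t ht) h1).congr_deriv ?_
    simp only [hw, hA]; field_simp
  have hud : ∀ t < 0, HasDerivAt u (u t * (A t + m - u t)) t := fun t ht => by
    have h1 := (hφm0 t ht).ne'
    refine ((hPd t ht).div (hφm t ht) h1).congr_deriv ?_
    change _ = P t / φm t * (A t + m - P t / φm t)
    change (P t * (A t + m) * φm t - P t * P t) / φm t ^ 2 = _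
    field_simp
  -- second order bound for w
  have hG : ∀ t < 0, 2 * (w t * (A t - w t)) ≤ A1 t := by
    have key : ∀ t < 0, 0 ≤ (φ t / w t) * (A1 t - 2 * (w t * (A t - w t))) := by
      have hd : ∀ t < 0, HasDerivAt (fun t => (φ t / w t) * (A1 t - 2 * (w t * (A t - w t))))
          ((φ t / w t) * (4 * c * (2 - c) * q t * (2 * q t * (1 + q t)))) t := fun t ht => by
        have hw0 : w t ≠ 0 := by linarith [hw1 t ht]
        have hA1d : HasDerivAt A1 (4 * c * (2 * q t * (1 + q t)) * (1 + q t) + 4 * c * q t * (2 * q t * (1 + q t))) t :=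
          ((hq t ht).const_mul (4 * c)).mul ((hq t ht).const_add 1)
        have hKw : K t = w t * φ t := by
          simp only [hw]; rw [div_mul_cancel₀ _ (hφ0 t ht).ne']
        refine (((hφ t ht).div (hwd t ht) hw0).mul
          (hA1d.sub (((hwd t ht).mul ((hAd t ht).sub (hwd t ht))).const_mul 2))).congr_deriv ?_
        simp only [Pi.sub_apply, Pi.mul_apply, Pi.div_apply]
        rw [hKw]
        simp only [hA1, hA]
        field_simp
        ring
      apply aux_nonneg_of_deriv hd
      · intro t ht
        have h1 := hq0 t ht
        have h2 := hφ0 t ht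
        have h3 : 0 < w t := by linarith [hw1 t ht]
        have h4 : 0 ≤ 2 - c := by linarith
        positivity
      · have hb : Filter.Tendsto (fun t => φ t * (A1 t + 2 * A t)) Filter.atBot (nhds 0) := by
          have hA1l : Filter.Tendsto A1 Filter.atBot (nhds 0) := by
            simpa using (hql.const_mul (4 * c)).mul (hql.const_add 1)
          simpa using hφl.mul (hA1l.add (hAl.const_mul 2))
        apply squeeze_zero_norm' _ hb
        filter_upwards [Filter.eventually_lt_atBot 0] with t ht
        have h1 := hw1 t ht
        have h2 := hwA t ht
        have h3 := hφ0 t ht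
        have h4 := hA1nn t ht
        have h5 : (φ t / w t) * (A1 t - 2 * (w t * (A t - w t))) =
            φ t * (A1 t / w t - 2 * (A t - w t)) := by
          field_simp
        rw [h5, norm_mul, Real.norm_of_nonneg h3.le]
        apply mul_le_mul_of_nonneg_left _ h3.le
        have h6 : A1 t / w t ≤ A1 t := div_le_self h4 h1
        have h7 : 0 ≤ A1 t / w t := by positivity
        rw [Real.norm_eq_abs, abs_le]
        constructor <;> linarith
    intro t ht
    have h1 := key t ht
    have h2 : 0 < φ t / w t := div_pos (hφ0 t ht) (by linarith [hw1 t ht])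
    have := nonneg_of_mul_nonneg_right h1 h2
    linarith
  have hV : ∀ t < 0, w t * (A t - w t) ≤ u t * (A t + m - u t) := by
    have key : ∀ t < 0, 0 ≤ (φm t / u t) * (u t * (A t + m - u t) - w t * (A t - w t)) := by
      have hd : ∀ t < 0, HasDerivAt (fun t => (φm t / u t) * (u t * (A t + m - u t) - w t * (A t - w t)))
          ((φm t / u t) * (m * (w t * (A t - w t)) + (u t - w t) * (A1 t - 2 * (w t * (A t - w t))))) t :=
          fun t ht => by
        have hu0 : u t ≠ 0 := by linarith [hu1 t ht]
        have hPu : Real.exp (m * t) * K t = u t * φm t := by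
          simp only [hu]; rw [div_mul_cancel₀ _ (hφm0 t ht).ne']
        refine (((hφm t ht).div (hud t ht) hu0).mul
          (((hud t ht).mul (((hAd t ht).add_const m).sub (hud t ht))).sub
            ((hwd t ht).mul ((hAd t ht).sub (hwd t ht))))).congr_deriv ?_
        simp only [Pi.sub_apply, Pi.mul_apply, Pi.div_apply]
        rw [hPu]
        generalize A t = A
        generalize A1 t = A1
        generalize w t = w
        generalize u t = u at *
        field_simp
        ring
      apply aux_nonneg_of_deriv hd
      · intro t ht
        have h1 := hu1 t ht
        have h2 := hφm0 t ht
        have h3 := hwu t ht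
        have h4 := hG t ht
        have h5 := hwA t ht
        have h6 := hw1 t ht
        apply mul_nonneg
        · positivity
        · apply add_nonneg
          · apply mul_nonneg hm (mul_nonneg (by linarith) (by linarith))
          · apply mul_nonneg <;> linarith
      · have hb : Filter.Tendsto (fun t => φm t * (A t + m + A t * A t)) Filter.atBot (nhds 0) := by
          simpa using hφml.mul ((hAl.add_const m).add (hAl.mul hAl))
        apply squeeze_zero_norm' _ hb
        filter_upwards [Filter.eventually_lt_atBot 0] with t ht
        have h1 := hw1 t ht
        have h2 := hwA t ht
        have h3 := hφm0 t ht
        have h4 := hu1 t ht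
        have h5 := huA t ht
        have h6 : (φm t / u t) * (u t * (A t + m - u t) - w t * (A t - w t)) =
            φm t * ((A t + m - u t) - (w t * (A t - w t)) / u t) := by
          field_simp
        rw [h6, norm_mul, Real.norm_of_nonneg h3.le]
        apply mul_le_mul_of_nonneg_left _ h3.le
        have h7 : 0 ≤ w t * (A t - w t) := mul_nonneg (by linarith) (by linarith)
        have h8 : (w t * (A t - w t)) / u t ≤ w t * (A t - w t) := div_le_self h7 h4
        have h9 : 0 ≤ (w t * (A t - w t)) / u t := by positivity
        have h10 : w t * (A t - w t) ≤ A t * A t := by nlinarith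
        rw [Real.norm_eq_abs, abs_le]
        constructor <;> nlinarith
    intro t ht
    have h1 := key t ht
    have h2 : 0 < φm t / u t := div_pos (hφm0 t ht) (by linarith [hu1 t ht])
    have := nonneg_of_mul_nonneg_right h1 h2
    linarith
  intro t ht
  exact ⟨hwu t ht, hV t ht⟩

lemma aux_k_cont (α : ℝ) : ContinuousOn (fun ρ : ℝ => ρ * (1 - ρ ^ 2) ^ α) (Ioo (-1) 1) := by
  apply continuousOn_id.mul
  apply ContinuousOn.rpow_const (by fun_prop)
  intro x hx
  left
  have : 0 < (1 - x) * (1 + x) := mul_pos (by linarith [hx.2]) (by linarith [hx.1])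
  nlinarith

lemma aux_one_sub_pos {t : ℝ} (ht : t < 0) : 0 < 1 - Real.exp t ^ 2 := by
  have h1 : Real.exp t < 1 := by simpa using ht
  have h2 := Real.exp_pos t
  nlinarith

lemma aux_ii (α : ℝ) {N : ℝ → ℝ} (hN : ContinuousOn N (Ioo (-1) 1)) {r : ℝ} (hr : r ∈ Ioo (-1:ℝ) 1) :
    IntervalIntegrable (fun ρ => N ρ * (ρ * (1 - ρ ^ 2) ^ α)) volume 0 r := by
  apply ContinuousOn.intervalIntegrable
  apply (hN.mul (aux_k_cont α)).mono
  exact (convex_Ioo (-1:ℝ) 1).ordConnected.uIcc_subset (by norm_num) hr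

lemma aux_Phi_deriv0 (α : ℝ) {N : ℝ → ℝ} (hN : ContinuousOn N (Ioo (-1) 1)) {r : ℝ} (hr : r ∈ Ioo (-1:ℝ) 1) :
    HasDerivAt (fun r => ∫ ρ in (0:ℝ)..r, N ρ * (ρ * (1 - ρ ^ 2) ^ α)) (N r * (r * (1 - r ^ 2) ^ α)) r := by
  have hc := hN.mul (aux_k_cont α)
  apply intervalIntegral.integral_hasDerivAt_right (aux_ii α hN hr)
  · exact hc.stronglyMeasurableAtFilter isOpen_Ioo r hr
  · exact hc.continuousAt (isOpen_Ioo.mem_nhds hr)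

lemma aux_exp_mem {t : ℝ} (ht : t < 0) : Real.exp t ∈ Ioo (-1:ℝ) 1 :=
  ⟨by linarith [Real.exp_pos t], by simpa using ht⟩

lemma aux_Phi_deriv (α : ℝ) {N : ℝ → ℝ} (hN : ContinuousOn N (Ioo (-1) 1)) {t : ℝ} (ht : t < 0) :
    HasDerivAt (fun t => ∫ ρ in (0:ℝ)..Real.exp t, N ρ * (ρ * (1 - ρ ^ 2) ^ α))
      (N (Real.exp t) * (Real.exp t * (Real.exp t * (1 - Real.exp t ^ 2) ^ α))) t := by
  have := (aux_Phi_deriv0 α hN (aux_exp_mem ht)).comp t (Real.hasDerivAt_exp t)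
  refine this.congr_deriv ?_
  ring

lemma aux_Phi_lim (α : ℝ) {N : ℝ → ℝ} (hN : ContinuousOn N (Ioo (-1) 1)) :
    Filter.Tendsto (fun t => ∫ ρ in (0:ℝ)..Real.exp t, N ρ * (ρ * (1 - ρ ^ 2) ^ α))
      Filter.atBot (nhds 0) := by
  have h := (aux_Phi_deriv0 α hN (r := 0) (by norm_num)).continuousAt.tendsto
  rw [intervalIntegral.integral_same] at h
  exact h.comp Real.tendsto_exp_atBot

lemma aux_Phi_pos (α : ℝ) {N : ℝ → ℝ} (hN : ContinuousOn N (Ioo (-1) 1))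
    (hpos : ∀ r ∈ Ioo (0:ℝ) 1, 0 < N r) {t : ℝ} (ht : t < 0) :
    0 < ∫ ρ in (0:ℝ)..Real.exp t, N ρ * (ρ * (1 - ρ ^ 2) ^ α) := by
  apply intervalIntegral.intervalIntegral_pos_of_pos_on (aux_ii α hN (aux_exp_mem ht)) _ (Real.exp_pos t)
  intro r hr
  have h1 : r < 1 := hr.2.trans (aux_exp_mem ht).2
  have h2 := hr.1
  have h3 : 0 < 1 - r ^ 2 := by nlinarith
  have := hpos r ⟨h2, h1⟩
  positivity

lemma aux_q_deriv {t : ℝ} (ht : t < 0) :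
    HasDerivAt (fun t => Real.exp t ^ 2 / (1 - Real.exp t ^ 2))
      (2 * (Real.exp t ^ 2 / (1 - Real.exp t ^ 2)) * (1 + Real.exp t ^ 2 / (1 - Real.exp t ^ 2))) t := by
  have h := aux_one_sub_pos ht
  have hd := (Real.hasDerivAt_exp t).pow 2
  refine (hd.div (hd.const_sub 1) h.ne').congr_deriv ?_
  simp only [Pi.pow_apply]
  have := h.ne'
  field_simp
  push_cast
  ring

lemma aux_K_deriv (α : ℝ) {t : ℝ} (ht : t < 0) :
    HasDerivAt (fun t => Real.exp t * (Real.exp t * (1 - Real.exp t ^ 2) ^ α))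
      (Real.exp t * (Real.exp t * (1 - Real.exp t ^ 2) ^ α) *
        (2 + 2 * (-α) * (Real.exp t ^ 2 / (1 - Real.exp t ^ 2)))) t := by
  have h := aux_one_sub_pos ht
  have hd := ((Real.hasDerivAt_exp t).pow 2).const_sub 1
  have hd2 := hd.rpow_const (p := α) (Or.inl h.ne')
  refine ((Real.hasDerivAt_exp t).mul ((Real.hasDerivAt_exp t).mul hd2)).congr_deriv ?_
  simp only [Pi.pow_apply, Pi.mul_apply]
  rw [Real.rpow_sub_one h.ne']
  have := h.ne'
  field_simp
  push_cast
  ring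

lemma aux_final {α : ℝ} (hα₁ : -2 ≤ α) (hα₂ : α ≤ 0) {N : ℝ → ℝ} (hN : ContinuousOn N (Ioo (-1) 1))
    (hpos : ∀ r ∈ Ioo (0:ℝ) 1, 0 < N r)
    (hconv : ConvexOn ℝ (Iio (0:ℝ)) (fun t => Real.log (N (Real.exp t))))
    (hmono : MonotoneOn (fun t => Real.log (N (Real.exp t))) (Iio (0:ℝ))) :
    ConvexOn ℝ (Iio (0:ℝ)) (fun t =>
      Real.log (∫ ρ in (0:ℝ)..Real.exp t, N ρ * (ρ * (1 - ρ ^ 2) ^ α)) -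
      Real.log (∫ ρ in (0:ℝ)..Real.exp t, 1 * (ρ * (1 - ρ ^ 2) ^ α))) := by
  set L : ℝ → ℝ := fun t => Real.log (N (Real.exp t)) with hL
  set K : ℝ → ℝ := fun t => Real.exp t * (Real.exp t * (1 - Real.exp t ^ 2) ^ α) with hK
  set q : ℝ → ℝ := fun t => Real.exp t ^ 2 / (1 - Real.exp t ^ 2) with hq
  set h : ℝ → ℝ := fun t => ∫ ρ in (0:ℝ)..Real.exp t, N ρ * (ρ * (1 - ρ ^ 2) ^ α) with hh
  set φ : ℝ → ℝ := fun t => ∫ ρ in (0:ℝ)..Real.exp t, 1 * (ρ * (1 - ρ ^ 2) ^ α) with hφ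
  have hone : ContinuousOn (fun _ : ℝ => (1:ℝ)) (Ioo (-1) 1) := continuousOn_const
  have hexpI : ∀ t < 0, Real.exp t ∈ Ioo (0:ℝ) 1 := fun t ht => ⟨Real.exp_pos t, (aux_exp_mem ht).2⟩
  have hNe : ∀ t < 0, N (Real.exp t) = Real.exp (L t) := fun t ht =>
    (Real.exp_log (hpos _ (hexpI t ht))).symm
  have hNpos : ∀ t < 0, 0 < N (Real.exp t) := fun t ht => hpos _ (hexpI t ht)
  have hh0 : ∀ t < 0, 0 < h t := fun t ht => aux_Phi_pos α hN hpos ht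
  have hφ0 : ∀ t < 0, 0 < φ t := fun t ht => aux_Phi_pos α hone (fun _ _ => one_pos) ht
  have hhd : ∀ t < 0, HasDerivAt h (N (Real.exp t) * K t) t := fun t ht => aux_Phi_deriv α hN ht
  have hφd : ∀ t < 0, HasDerivAt φ (K t) t := fun t ht => by
    exact (aux_Phi_deriv α hone ht).congr_deriv (one_mul _)
  have hqd : ∀ t < 0, HasDerivAt q (2 * q t * (1 + q t)) t := fun t ht => aux_q_deriv ht
  have hq0 : ∀ t < 0, 0 < q t := fun t ht => div_pos (by positivity) (aux_one_sub_pos ht)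
  have hKd : ∀ t < 0, HasDerivAt K (K t * (2 + 2 * (-α) * q t)) t := fun t ht => aux_K_deriv α ht
  have hK0 : ∀ t < 0, 0 < K t := fun t ht => by
    have := aux_one_sub_pos ht
    simp only [hK]; positivity
  have hql : Filter.Tendsto q Filter.atBot (nhds 0) := by
    have h1 : Filter.Tendsto (fun t => Real.exp t ^ 2) Filter.atBot (nhds 0) := by
      simpa using Real.tendsto_exp_atBot.pow 2
    have h2 := h1.div (h1.const_sub 1) (by norm_num)
    rw [zero_div] at h2
    exact h2
  have hKl : Filter.Tendsto K Filter.atBot (nhds 0) := by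
    have h1 : ContinuousAt (fun ρ : ℝ => ρ * (1 - ρ ^ 2) ^ α) 0 :=
      (aux_k_cont α).continuousAt (isOpen_Ioo.mem_nhds (by norm_num))
    have h2 := Real.tendsto_exp_atBot.mul (h1.tendsto.comp Real.tendsto_exp_atBot)
    simpa using! h2
  have hφl : Filter.Tendsto φ Filter.atBot (nhds 0) := aux_Phi_lim α hone
  -- the key pointwise inequality
  have hcore : ∀ t < 0, 0 ≤ N (Real.exp t) * K t / h t * (2 + 2 * (-α) * q t + derivWithin L (Ioi t) t
      - N (Real.exp t) * K t / h t) - K t / φ t * (2 + 2 * (-α) * q t - K t / φ t) := by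
    intro t ht
    have htI : t ∈ interior (Iio (0:ℝ)) := by rw [interior_Iio]; exact ht
    set m := derivWithin L (Ioi t) t with hm
    have hslope : ∀ s < t, L t + m * (s - t) ≤ L s := by
      intro s hs
      have h1 := hconv.slope_le_leftDeriv_of_mem_interior (x := s) (y := t) (lt_trans hs ht) htI hs
      have h2 := hconv.leftDeriv_le_rightDeriv_of_mem_interior htI
      have h3 := h1.trans h2
      rw [slope_def_field, div_le_iff₀ (by linarith)] at h3
      simp only [← hm] at h3
      linarith
    have hm0 : 0 ≤ m := by
      have h1 := hconv.slope_le_leftDeriv_of_mem_interior (x := t - 1) (y := t)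
        (show t - 1 < 0 by linarith) htI (by linarith)
      have h2 := hconv.leftDeriv_le_rightDeriv_of_mem_interior htI
      have h3 := h1.trans h2
      refine le_trans ?_ h3
      rw [slope_def_field]
      apply div_nonneg _ (by linarith)
      have := hmono (show t - 1 ∈ Iio (0:ℝ) by simp; linarith) (show t ∈ Iio (0:ℝ) from ht) (by linarith)
      linarith
    have hpm : ContinuousOn (fun ρ : ℝ => ρ ^ m) (Ioo (-1) 1) :=
      continuousOn_id.rpow_const (fun _ _ => Or.inr hm0)
    set φm : ℝ → ℝ := fun t => ∫ ρ in (0:ℝ)..Real.exp t, ρ ^ m * (ρ * (1 - ρ ^ 2) ^ α) with hφm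
    have hφm0 : ∀ t < 0, 0 < φm t := fun t ht =>
      aux_Phi_pos α hpm (fun r hr => Real.rpow_pos_of_pos hr.1 _) ht
    have hφmd : ∀ t < 0, HasDerivAt φm (Real.exp (m * t) * K t) t := fun t ht => by
      refine (aux_Phi_deriv α hpm ht).congr_deriv ?_
      rw [← Real.exp_mul, mul_comm t m]
    obtain ⟨c1, c2⟩ := aux_ode_core (by linarith) (by linarith) hm0 hqd hq0 hql hKd hK0 hKl hφd hφ0 hφl
      hφmd hφm0 (aux_Phi_lim α hpm) t ht
    have hle1 : Real.exp (L t) * Real.exp (-(m * t)) * φm t ≤ h t := by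
      simp only [hφm, hh]
      rw [← intervalIntegral.integral_const_mul]
      apply intervalIntegral.integral_mono_on_of_le_Ioo (Real.exp_pos t).le
        ((aux_ii α hpm (aux_exp_mem ht)).const_mul _) (aux_ii α hN (aux_exp_mem ht))
      intro r hr
      have hr1 : r < 1 := hr.2.trans (aux_exp_mem ht).2
      have hlog : Real.log r < t := (Real.log_lt_iff_lt_exp hr.1).2 hr.2
      have h1 := hslope _ hlog
      have h2 : N r = Real.exp (L (Real.log r)) := by
        rw [← hNe _ (hlog.trans ht), Real.exp_log hr.1]
      rw [← mul_assoc, h2, Real.rpow_def_of_pos hr.1, ← Real.exp_add, ← Real.exp_add]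
      have h3 : 0 < 1 - r ^ 2 := by nlinarith [hr.1]
      have h4 : 0 ≤ r * (1 - r ^ 2) ^ α := mul_nonneg hr.1.le (Real.rpow_nonneg h3.le _)
      apply mul_le_mul_of_nonneg_right _ h4
      rw [Real.exp_le_exp]
      linarith
    have hle2 : h t ≤ Real.exp (L t) * φ t := by
      simp only [hφ, hh]
      rw [← intervalIntegral.integral_const_mul]
      apply intervalIntegral.integral_mono_on_of_le_Ioo (Real.exp_pos t).le
        (aux_ii α hN (aux_exp_mem ht)) ((aux_ii α hone (aux_exp_mem ht)).const_mul _)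
      intro r hr
      have hr1 : r < 1 := hr.2.trans (aux_exp_mem ht).2
      have hlog : Real.log r < t := (Real.log_lt_iff_lt_exp hr.1).2 hr.2
      have h1 : L (Real.log r) ≤ L t := hmono (hlog.trans ht) ht hlog.le
      have h2 : N r = Real.exp (L (Real.log r)) := by
        rw [← hNe _ (hlog.trans ht), Real.exp_log hr.1]
      rw [one_mul, h2]
      have h3 : 0 < 1 - r ^ 2 := by nlinarith [hr.1]
      have h4 : 0 ≤ r * (1 - r ^ 2) ^ α := mul_nonneg hr.1.le (Real.rpow_nonneg h3.le _)
      apply mul_le_mul_of_nonneg_right _ h4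
      rw [Real.exp_le_exp]
      exact h1
    have hwu : K t / φ t ≤ N (Real.exp t) * K t / h t := by
      rw [div_le_div_iff₀ (hφ0 t ht) (hh0 t ht), hNe t ht]
      nlinarith [hK0 t ht]
    have huum : N (Real.exp t) * K t / h t ≤ Real.exp (m * t) * K t / φm t := by
      rw [div_le_div_iff₀ (hh0 t ht) (hφm0 t ht), hNe t ht]
      have h5 : Real.exp (m * t) * (Real.exp (L t) * Real.exp (-(m * t)) * φm t) = Real.exp (L t) * φm t := by
        rw [Real.exp_neg]; field_simp
      have h6 := mul_le_mul_of_nonneg_left hle1 (Real.exp_pos (m * t)).le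
      rw [h5] at h6
      have h7 := mul_le_mul_of_nonneg_right h6 (hK0 t ht).le
      linarith
    have hw0 : 0 < K t / φ t := div_pos (hK0 t ht) (hφ0 t ht)
    generalize N (Real.exp t) * K t / h t = u at *
    generalize Real.exp (m * t) * K t / φm t = um at *
    generalize K t / φ t = w at *
    generalize 2 + 2 * (-α) * q t = A at *
    by_cases hcase : u ≤ A + m - w
    · have : 0 ≤ (u - w) * (A + m - u - w) := mul_nonneg (by linarith) (by linarith)
      nlinarith
    · have : 0 ≤ (um - u) * (u + um - A - m) := mul_nonneg (by linarith) (by linarith)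
      nlinarith
  -- monotonicity of the derivative
  set B : ℝ → ℝ := fun t => N (Real.exp t) * K t / h t - K t / φ t with hB
  have hNc : ContinuousOn (fun t => N (Real.exp t)) (Iio 0) :=
    hN.comp Real.continuous_exp.continuousOn (fun t ht => aux_exp_mem ht)
  have hBc : ContinuousOn B (Iio 0) := by
    have hKc : ContinuousOn K (Iio 0) := fun t ht => (hKd t ht).continuousAt.continuousWithinAt
    apply ContinuousOn.sub
    · apply (hNc.mul hKc).div (fun t ht => (hhd t ht).continuousAt.continuousWithinAt)
      exact fun t ht => (hh0 t ht).ne'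
    · apply hKc.div (fun t ht => (hφd t ht).continuousAt.continuousWithinAt)
      exact fun t ht => (hφ0 t ht).ne'
  have hBd : ∀ t < 0, HasDerivWithinAt B (N (Real.exp t) * K t / h t * (2 + 2 * (-α) * q t + derivWithin L (Ioi t) t
      - N (Real.exp t) * K t / h t) - K t / φ t * (2 + 2 * (-α) * q t - K t / φ t)) (Ici t) t := by
    intro t ht
    have htI : t ∈ interior (Iio (0:ℝ)) := by rw [interior_Iio]; exact ht
    have h1 : HasDerivWithinAt L (derivWithin L (Ioi t) t) (Ici t) t :=
      (hconv.hasDerivWithinAt_rightDeriv_of_mem_interior htI).Ici_of_Ioi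
    have h2 : HasDerivWithinAt (fun t => N (Real.exp t)) (N (Real.exp t) * derivWithin L (Ioi t) t) (Ici t) t := by
      have h3 := h1.exp
      rw [← hNe t ht] at h3
      apply h3.congr_of_eventuallyEq _ (hNe t ht)
      filter_upwards [mem_nhdsWithin_of_mem_nhds (isOpen_Iio.mem_nhds (show t ∈ Iio (0:ℝ) from ht))] with s hs
      exact hNe s hs
    have hn1 := (hh0 t ht).ne'
    have hn2 := (hφ0 t ht).ne'
    refine (((h2.mul (hKd t ht).hasDerivWithinAt).div (hhd t ht).hasDerivWithinAt hn1).sub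
      ((hKd t ht).hasDerivWithinAt.div (hφd t ht).hasDerivWithinAt hn2)).congr_deriv ?_
    simp only [Pi.mul_apply]
    field_simp
    ring
  have hBmono : MonotoneOn B (Iio 0) := by
    intro a ha b hb hab
    have ha' : a < 0 := ha
    have hb' : b < 0 := hb
    exact image_le_of_deriv_right_le_deriv_boundary (f := fun _ => B a) (f' := fun _ => 0)
      (a := a) (b := b) continuousOn_const (fun x _ => hasDerivWithinAt_const _ _ _) le_rfl
      (hBc.mono (fun x hx => lt_of_le_of_lt hx.2 hb')) (fun x hx => hBd x (hx.2.trans hb'))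
      (fun x hx => hcore x (hx.2.trans hb')) (right_mem_Icc.2 hab)
  have hFd : ∀ t < 0, HasDerivAt (fun t => Real.log (h t) - Real.log (φ t)) (B t) t := fun t ht =>
    ((hhd t ht).log (hh0 t ht).ne').sub ((hφd t ht).log (hφ0 t ht).ne')
  apply MonotoneOn.convexOn_of_deriv (convex_Iio 0)
  · exact fun t ht => (hFd t ht).continuousAt.continuousWithinAt
  · rw [interior_Iio]
    exact fun t ht => (hFd t ht).differentiableAt.differentiableWithinAt
  · rw [interior_Iio]
    exact hBmono.congr (fun t ht => (hFd t ht).deriv.symm)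

lemma aux_mean_pos {f : ℂ → ℂ} {p : ℝ} (hf : DifferentiableOn ℂ f (Metric.ball 0 1)) (hp : 0 < p)
    (hnc : ¬ ∃ c : ℂ, ∀ z ∈ Metric.ball (0 : ℂ) 1, f z = c) {r : ℝ} (hr : r ∈ Ioo (0:ℝ) 1) :
    0 < ∫ s in (0:ℝ)..2*π, ‖f (circleMap 0 r s)‖^p := by
  have hmem : ∀ s, circleMap 0 r s ∈ Metric.ball (0:ℂ) 1 := fun s => by
    simp [abs_of_pos hr.1, hr.2]
  have hc : Continuous (fun s => ‖f (circleMap 0 r s)‖^p) := by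
    have h1 : Continuous (fun s => f (circleMap 0 r s)) :=
      hf.continuousOn.comp_continuous (continuous_circleMap 0 r) hmem
    exact h1.norm.rpow_const (fun _ => Or.inr hp.le)
  by_contra hneg
  have hz : ∀ s ∈ Icc (0:ℝ) (2*π), f (circleMap 0 r s) = 0 := by
    by_contra! hcon
    obtain ⟨s, hs, hne⟩ := hcon
    apply hneg
    apply intervalIntegral.integral_pos Real.two_pi_pos hc.continuousOn
      (fun _ _ => by positivity) ⟨s, hs, ?_⟩
    have : 0 < ‖f (circleMap 0 r s)‖ := norm_pos_iff.2 hne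
    positivity
  have hsph : EqOn f (fun _ => 0) (frontier (Metric.ball (0:ℂ) r)) := by
    rw [frontier_ball _ hr.1.ne']
    intro z hz'
    rw [← abs_of_pos hr.1, ← image_circleMap_Ioc] at hz'
    obtain ⟨s, hs, rfl⟩ := hz'
    exact hz s ⟨hs.1.le, hs.2⟩
  have hsub : Metric.closedBall (0:ℂ) r ⊆ Metric.ball 0 1 := Metric.closedBall_subset_ball hr.2
  have hd : DiffContOnCl ℂ f (Metric.ball (0:ℂ) r) :=
    DifferentiableOn.diffContOnCl (hf.mono (Metric.closure_ball_subset_closedBall.trans hsub))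
  have h0 := Complex.eqOn_of_eqOn_frontier Metric.isBounded_ball hd diffContOnCl_const hsph
  have ha : AnalyticOnNhd ℂ f (Metric.ball 0 1) := hf.analyticOnNhd Metric.isOpen_ball
  have := ha.eqOn_zero_of_preconnected_of_eventuallyEq_zero
    (convex_ball (0:ℂ) 1).isPreconnected (Metric.mem_ball_self one_pos)
    (h0.eventuallyEq_of_mem (Metric.ball_mem_nhds 0 hr.1))
  exact hnc ⟨0, fun z hz => this hz⟩

lemma aux_mono {N : ℝ → ℝ} (hN : ContinuousOn N (Ioo (-1) 1))
    (hpos : ∀ r ∈ Ioo (0:ℝ) 1, 0 < N r)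
    (hconv : ConvexOn ℝ (Iio 0) fun t => Real.log (N (Real.exp t))) :
    MonotoneOn (fun t => Real.log (N (Real.exp t))) (Iio 0) := by
  have hb : ∃ C : ℝ, ∀ᶠ t in Filter.atBot, Real.log (N (Real.exp t)) ≤ C := by
    have h1 : ContinuousAt N 0 := hN.continuousAt (isOpen_Ioo.mem_nhds (by norm_num))
    have h2 : Filter.Tendsto (fun t => N (Real.exp t)) Filter.atBot (nhds (N 0)) :=
      h1.tendsto.comp Real.tendsto_exp_atBot
    refine ⟨N 0 + 1, ?_⟩
    filter_upwards [h2.eventually (gt_mem_nhds (lt_add_one (N 0))), Filter.eventually_lt_atBot 0] with t h3 h4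
    have := Real.log_le_sub_one_of_pos (hpos _ (⟨Real.exp_pos t, by simpa using h4⟩))
    linarith
  obtain ⟨C, hC⟩ := hb
  set L := fun t => Real.log (N (Real.exp t)) with hL
  intro s hs t ht hst
  by_contra! hlt
  have hst' : s < t := lt_of_le_of_ne hst (fun h => by subst h; exact lt_irrefl _ hlt)
  have hd : (L t - L s) / (t - s) < 0 := div_neg_of_neg_of_pos (by linarith) (by linarith)
  set d := (L t - L s) / (t - s) with hdd
  have hx : ∀ x < s, L s - d * (s - x) ≤ L x := by
    intro x hx
    have h1 := hconv.slope_mono_adjacent (x := x) (y := s) (z := t) (hx.trans hs) ht hx hst'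
    rw [div_le_iff₀ (by linarith)] at h1
    change L s - L x ≤ d * (s - x) at h1
    linarith
  obtain ⟨x, ⟨h1, h2⟩, h3⟩ := ((hC.and (Filter.eventually_lt_atBot s)).and
    (Filter.eventually_lt_atBot (s - (C - L s) / (-d)))).exists
  have h4 := hx x h2
  have h5 : (C - L s) / (-d) < s - x := by linarith
  rw [div_lt_iff₀ (by linarith)] at h5
  change L x ≤ C at h1
  nlinarith

lemma aux_polar {f : ℂ → ℂ} {p : ℝ} (α : ℝ) (hf : DifferentiableOn ℂ f (Metric.ball 0 1)) (hp : 0 < p)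
    {R : ℝ} (hR : R ∈ Ioo (0:ℝ) 1) :
    ∫ z in Metric.ball (0:ℂ) R, ‖f z‖ ^ p * (1 - ‖z‖ ^ 2) ^ α =
      ∫ ρ in (0:ℝ)..R, (∫ s in (0:ℝ)..2*π, ‖f (circleMap 0 ρ s)‖^p) * (ρ * (1 - ρ ^ 2) ^ α) := by
  set H : ℝ × ℝ → ℝ := fun q => ‖f (circleMap 0 q.1 q.2)‖ ^ p * (q.1 * (1 - q.1 ^ 2) ^ α) with hH
  have hcs : ∀ q : ℝ × ℝ, Complex.polarCoord.symm q = circleMap 0 q.1 q.2 := by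
    intro q
    rw [Complex.polarCoord_symm_apply, circleMap_zero, Complex.exp_mul_I]
    push_cast
    ring
  have hcont : ContinuousOn H (Icc 0 R ×ˢ Icc (-π) π) := by
    have h1 : ContinuousOn (fun q : ℝ × ℝ => f (circleMap 0 q.1 q.2)) (Icc 0 R ×ˢ Icc (-π) π) := by
      apply hf.continuousOn.comp
      · unfold circleMap; fun_prop
      · rintro q ⟨h1, h2⟩
        simp only [mem_ball_zero_iff, norm_circleMap_zero, abs_of_nonneg h1.1]
        exact h1.2.trans_lt hR.2
    apply (h1.norm.rpow_const (fun _ _ => Or.inr hp.le)).mul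
    apply continuousOn_fst.mul
    apply ContinuousOn.rpow_const
    · fun_prop
    · rintro q ⟨h1, h2⟩
      left
      have := h1.1
      have := h1.2.trans_lt hR.2
      have : 0 < 1 - q.1 ^ 2 := by nlinarith
      exact this.ne'
  have hint : IntegrableOn H (Ioo 0 R ×ˢ Ioo (-π) π) (volume.prod volume) :=
    (hcont.integrableOn_compact (isCompact_Icc.prod isCompact_Icc)).mono_set
      (prod_mono Ioo_subset_Icc_self Ioo_subset_Icc_self)
  have hset : polarCoord.target ∩ (Iio R ×ˢ univ) = Ioo 0 R ×ˢ Ioo (-π) π := by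
    rw [polarCoord_target, prod_inter_prod, inter_univ, Ioi_inter_Iio]
  have hmt : MeasurableSet polarCoord.target := polarCoord.open_target.measurableSet
  rw [← integral_indicator Metric.isOpen_ball.measurableSet, ← Complex.integral_comp_polarCoord_symm]
  have e1 : ∫ q in polarCoord.target, q.1 • (Metric.ball (0:ℂ) R).indicator
      (fun z => ‖f z‖ ^ p * (1 - ‖z‖ ^ 2) ^ α) (Complex.polarCoord.symm q)
      = ∫ q in polarCoord.target, (Iio R ×ˢ univ).indicator H q := by
    apply setIntegral_congr_fun hmt
    intro q hq
    rw [polarCoord_target] at hq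
    have hq1 : 0 < q.1 := hq.1
    have hn : ‖circleMap 0 q.1 q.2‖ = q.1 := by simp [abs_of_pos hq1]
    simp only [hcs]
    by_cases hqR : q.1 < R
    · rw [indicator_of_mem (by simpa [mem_ball_zero_iff, abs_of_pos hq1] using hqR), indicator_of_mem (by simpa using hqR)]
      simp only [hH, smul_eq_mul, hn]
      ring
    · rw [indicator_of_notMem (by simpa [mem_ball_zero_iff, abs_of_pos hq1] using hqR), indicator_of_notMem (by simpa using hqR)]
      simp
  rw [e1, setIntegral_indicator (measurableSet_Iio.prod MeasurableSet.univ), hset,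
    Measure.volume_eq_prod, setIntegral_prod _ hint, intervalIntegral.integral_of_le hR.1.le,
    integral_Ioc_eq_integral_Ioo]
  apply setIntegral_congr_fun measurableSet_Ioo
  intro ρ hρ
  simp only [hH]
  rw [integral_mul_const]
  congr 1
  rw [← integral_Ioc_eq_integral_Ioo, ← intervalIntegral.integral_of_le (by linarith [Real.pi_pos])]
  have hper : Function.Periodic (fun s => ‖f (circleMap 0 ρ s)‖ ^ p) (2 * π) := by
    intro s
    simp only [periodic_circleMap 0 ρ s]
  have := hper.intervalIntegral_add_eq (-π) 0
  rw [zero_add, show -π + 2 * π = π by ring] at this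
  exact this

/-- **Logarithmic convexity of area integral means.**
For `0 < p < ∞`, `-2 ≤ α ≤ 0`, and a non-constant analytic function `f` on the unit
disk, the area integral mean `M_{p,α}(f,r)` is logarithmically convex on `(0,1)`,
i.e. `t ↦ log M_{p,α}(f, e^t)` is convex on `(-∞,0)`. -/
theorem log_convex_area_integral_mean (p α : ℝ) (hp : 0 < p) (hα₁ : -2 ≤ α) (hα₂ : α ≤ 0)
    (f : ℂ → ℂ) (hf : DifferentiableOn ℂ f (Metric.ball 0 1))
    (hnc : ¬ ∃ c : ℂ, ∀ z ∈ Metric.ball (0 : ℂ) 1, f z = c) :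
    ConvexOn ℝ (Iio (0 : ℝ)) (fun t : ℝ =>
      Real.log ((∫ z in Metric.ball (0 : ℂ) (Real.exp t), ‖f z‖ ^ p * (1 - ‖z‖ ^ 2) ^ α) /
        (∫ z in Metric.ball (0 : ℂ) (Real.exp t), (1 - ‖z‖ ^ 2) ^ α))) := by
  set N : ℝ → ℝ := fun r => ∫ s in (0:ℝ)..2*π, ‖f (circleMap 0 r s)‖^p with hNdef
  have hpos : ∀ r ∈ Ioo (0:ℝ) 1, 0 < N r := fun r hr => aux_mean_pos hf hp hnc hr
  have hN : ContinuousOn N (Ioo (-1) 1) := aux_mean_continuousOn hf hp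
  have hE : ∀ t < (0:ℝ), Real.exp t ∈ Ioo (0:ℝ) 1 := fun t ht => ⟨Real.exp_pos t, by simpa using ht⟩
  have hconv : ConvexOn ℝ (Iio 0) fun t => Real.log (N (Real.exp t)) :=
    aux_hardy hf hp (fun t ht => hpos _ (hE t ht))
  have hfin := aux_final hα₁ hα₂ hN hpos hconv (aux_mono hN hpos hconv)
  refine (hfin.add_const (-Real.log (2 * π))).congr ?_
  intro t ht
  have ht' : t < 0 := ht
  have hden : ∫ z in Metric.ball (0 : ℂ) (Real.exp t), (1 - ‖z‖ ^ 2) ^ α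
      = 2 * π * ∫ ρ in (0:ℝ)..Real.exp t, 1 * (ρ * (1 - ρ ^ 2) ^ α) := by
    have := aux_polar (f := fun _ => 1) (p := p) α (differentiableOn_const _) hp (hE t ht')
    simp only [norm_one, Real.one_rpow, one_mul, intervalIntegral.integral_const, sub_zero,
      smul_eq_mul, mul_one, intervalIntegral.integral_const_mul] at this
    simp only [one_mul]
    exact this
  have h1 : 0 < ∫ ρ in (0:ℝ)..Real.exp t, N ρ * (ρ * (1 - ρ ^ 2) ^ α) := aux_Phi_pos α hN hpos ht'
  have h2 : 0 < ∫ ρ in (0:ℝ)..Real.exp t, 1 * (ρ * (1 - ρ ^ 2) ^ α) :=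
    aux_Phi_pos α (N := fun _ => 1) continuousOn_const (fun _ _ => one_pos) ht'
  simp only
  rw [hden, aux_polar α hf hp (hE t ht'), Real.log_div h1.ne' (by positivity),
    Real.log_mul (by positivity) h2.ne']
  simp only [Pi.add_apply]
  ring
end

section
/- Let −2 ≤ α ≤ 0 and let M be a positive, non-decreasing, twice differentiable function on (0,1) such that log M(x) is convex in log x. Then the function x ↦ log( (∫₀ˣ M(t)(1−t)^α dt) / (∫₀ˣ (1−t)^α dt) ) is convex in log x on (0,1). -/
open Real Set

lemma lcwm_nonneg_of_lim (f f' g : ℝ → ℝ)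
    (hf : ∀ x ∈ Ioo (0 : ℝ) 1, HasDerivAt f (f' x) x)
    (hf' : ∀ x ∈ Ioo (0 : ℝ) 1, 0 ≤ f' x)
    (hg : ∀ x ∈ Ioo (0 : ℝ) 1, g x ≤ f x)
    (hlim : Filter.Tendsto g (nhdsWithin 0 (Ioi 0)) (nhds 0)) :
    ∀ x ∈ Ioo (0 : ℝ) 1, 0 ≤ f x := by
  have hm : MonotoneOn f (Ioo (0 : ℝ) 1) := by
    apply monotoneOn_of_deriv_nonneg (convex_Ioo 0 1)
    · exact fun x hx => (hf x hx).continuousAt.continuousWithinAt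
    · intro x hx
      rw [interior_Ioo] at hx
      exact (hf x hx).differentiableAt.differentiableWithinAt
    · intro x hx
      rw [interior_Ioo] at hx
      rw [(hf x hx).deriv]
      exact hf' x hx
  intro x hx
  apply le_of_tendsto hlim
  filter_upwards [Ioo_mem_nhdsGT hx.1] with e he
  have he1 : e ∈ Ioo (0 : ℝ) 1 := ⟨he.1, he.2.trans hx.2⟩
  exact (hg e he1).trans (hm he1 hx he.2.le)

lemma lcwm_core (a : ℝ) (ha0 : 0 ≤ a) (ha2 : a ≤ 2) (w φ h M p p' : ℝ → ℝ)
    (hw : ∀ x ∈ Ioo (0 : ℝ) 1, 0 < w x)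
    (hw' : ∀ x ∈ Ioo (0 : ℝ) 1, HasDerivAt w (a * w x / (1 - x)) x)
    (hφ : ∀ x ∈ Ioo (0 : ℝ) 1, 0 < φ x)
    (hφ' : ∀ x ∈ Ioo (0 : ℝ) 1, HasDerivAt φ (w x) x)
    (hh : ∀ x ∈ Ioo (0 : ℝ) 1, 0 < h x)
    (hh' : ∀ x ∈ Ioo (0 : ℝ) 1, HasDerivAt h (M x * w x) x)
    (hM : ∀ x ∈ Ioo (0 : ℝ) 1, 0 < M x)
    (hM' : ∀ x ∈ Ioo (0 : ℝ) 1, HasDerivAt M (p x * M x / x) x)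
    (hp : ∀ x ∈ Ioo (0 : ℝ) 1, 0 ≤ p x)
    (hpd : ∀ x ∈ Ioo (0 : ℝ) 1, HasDerivAt p (p' x) x)
    (hp' : ∀ x ∈ Ioo (0 : ℝ) 1, 0 ≤ p' x)
    (lφ : Filter.Tendsto φ (nhdsWithin 0 (Ioi 0)) (nhds 0))
    (lh : Filter.Tendsto h (nhdsWithin 0 (Ioi 0)) (nhds 0))
    (lw : Filter.Tendsto (fun x => x * w x) (nhdsWithin 0 (Ioi 0)) (nhds 0))
    (lM : Filter.Tendsto (fun x => x * w x * M x) (nhdsWithin 0 (Ioi 0)) (nhds 0)) :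
    MonotoneOn (fun x => x * w x * M x / h x - x * w x / φ x) (Ioo (0 : ℝ) 1) := by
  have hk' : ∀ x ∈ Ioo (0 : ℝ) 1,
      HasDerivAt (fun x : ℝ => 1 + a * x / (1 - x)) (a / (1 - x) ^ 2) x := by
    intro x hx
    have h1 : (1 - x) ≠ 0 := by linarith [hx.2]
    have := (((hasDerivAt_id x).const_mul a).div ((hasDerivAt_id x).const_sub 1) h1).const_add 1
    refine HasDerivAt.congr_deriv (this) ?_
    simp only [id]
    field_simp
    ring
  have hk1 : ∀ x ∈ Ioo (0 : ℝ) 1, 1 ≤ 1 + a * x / (1 - x) := by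
    intro x hx
    have : 0 ≤ a * x / (1 - x) := div_nonneg (mul_nonneg ha0 hx.1.le) (by linarith [hx.2])
    linarith
  have lk : Filter.Tendsto (fun x : ℝ => 1 + a * x / (1 - x)) (nhdsWithin 0 (Ioi 0)) (nhds 1) := by
    have : ContinuousAt (fun x : ℝ => 1 + a * x / (1 - x)) 0 := by
      apply ContinuousAt.add continuousAt_const
      apply ContinuousAt.div (by fun_prop) (by fun_prop) (by norm_num)
    have h2 := this.tendsto
    simp only [mul_zero, zero_div, add_zero] at h2
    exact h2.mono_left nhdsWithin_le_nhds
  -- h ≤ M φ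
  have e1 : ∀ x ∈ Ioo (0 : ℝ) 1, 0 ≤ M x * φ x - h x := by
    apply lcwm_nonneg_of_lim _ (fun x => p x * M x / x * φ x) (fun x => - h x)
    · intro x hx
      refine HasDerivAt.congr_deriv (((hM' x hx).mul (hφ' x hx)).sub (hh' x hx)) ?_
      ring
    · intro x hx
      have := hp x hx; have := hM x hx; have := hx.1; have := hφ x hx
      positivity
    · intro x hx
      nlinarith [mul_pos (hM x hx) (hφ x hx)]
    · simpa using lh.neg
  -- B ≤ k
  have e2 : ∀ x ∈ Ioo (0 : ℝ) 1, 0 ≤ (1 + a * x / (1 - x)) * φ x - x * w x := by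
    apply lcwm_nonneg_of_lim _ (fun x => a / (1 - x) ^ 2 * φ x) (fun x => - (x * w x))
    · intro x hx
      have h1 : (1 - x) ≠ 0 := by linarith [hx.2]
      refine HasDerivAt.congr_deriv (((hk' x hx).mul (hφ' x hx)).sub ((hasDerivAt_id x).mul (hw' x hx))) ?_
      simp only [id]
      field_simp
      ring
    · intro x hx
      have := hφ x hx
      positivity
    · intro x hx
      nlinarith [mul_nonneg (zero_le_one.trans (hk1 x hx)) (hφ x hx).le]
    · simpa using lw.neg
  -- K
  have e3 : ∀ x ∈ Ioo (0 : ℝ) 1, 0 ≤ a * φ x ^ 2 / ((1 - x) ^ 2 * w x)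
      - 2 * ((1 + a * x / (1 - x)) * φ x) + 2 * (x * w x) := by
    apply lcwm_nonneg_of_lim _ (fun x => a * (2 - a) * φ x ^ 2 / (w x * (1 - x) ^ 3))
      (fun x => - 2 * ((1 + a * x / (1 - x)) * φ x))
    · intro x hx
      have h1 : (1 - x) ≠ 0 := by linarith [hx.2]
      have h2 : w x ≠ 0 := (hw x hx).ne'
      have hd : HasDerivAt (fun x : ℝ => 1 - x) (-1) x := (hasDerivAt_id x).const_sub 1
      refine HasDerivAt.congr_deriv ((((((hφ' x hx).pow 2).const_mul a).div ((hd.pow 2).mul (hw' x hx))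
        (mul_ne_zero (pow_ne_zero 2 h1) h2)).sub
        (((hk' x hx).mul (hφ' x hx)).const_mul 2)).add
        (((hasDerivAt_id x).mul (hw' x hx)).const_mul 2)) ?_
      simp only [id, Pi.mul_apply, Pi.pow_apply]
      field_simp
      push_cast
      ring
    · intro x hx
      have := hφ x hx
      have := hw x hx
      have h1 : 0 < (1 - x) := by linarith [hx.2]
      have h2 : 0 ≤ 2 - a := by linarith
      positivity
    · intro x hx
      have := hφ x hx
      have := hw x hx
      have := hx.1
      have h1 : 0 < (1 - x) := by linarith [hx.2]
      have h3 : 0 ≤ a * φ x ^ 2 / ((1 - x) ^ 2 * w x) := by positivity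
      have h4 : 0 < x * w x := by positivity
      linarith
    · simpa using (lk.mul lφ).const_mul (-2)
  -- J
  have e4 : ∀ x ∈ Ioo (0 : ℝ) 1, 0 ≤ p x * h x - (1 - h x / (M x * φ x)) *
      (x * w x * M x + x * w x * h x / φ x - (1 + a * x / (1 - x)) * h x) := by
    apply lcwm_nonneg_of_lim _ (fun x => p' x * h x +
      h x * (M x * φ x - h x) / (x * M x * φ x) * ((a * φ x ^ 2 / ((1 - x) ^ 2 * w x)
      - 2 * ((1 + a * x / (1 - x)) * φ x) + 2 * (x * w x)) * (x * w x) / φ x ^ 2)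
      + h x ^ 2 / (x * M x * φ x ^ 2) * p x * ((1 + a * x / (1 - x)) * φ x - x * w x))
      (fun x => - 2 * (x * w x * M x))
    · intro x hx
      have h1 : (1 - x) ≠ 0 := by linarith [hx.2]
      have h0 : x ≠ 0 := hx.1.ne'
      have h2 : w x ≠ 0 := (hw x hx).ne'
      have h3 : φ x ≠ 0 := (hφ x hx).ne'
      have h4 : M x ≠ 0 := (hM x hx).ne'
      have h5 : h x ≠ 0 := (hh x hx).ne'
      have hxw := (hasDerivAt_id x).mul (hw' x hx)
      refine HasDerivAt.congr_deriv (((hpd x hx).mul (hh' x hx)).sub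
        ((((hh' x hx).div ((hM' x hx).mul (hφ' x hx)) (mul_ne_zero h4 h3)).const_sub 1).mul
        (((hxw.mul (hM' x hx)).add ((hxw.mul (hh' x hx)).div (hφ' x hx) h3)).sub
          ((hk' x hx).mul (hh' x hx))))) ?_
      simp only [id, Pi.mul_apply, Pi.pow_apply, Pi.div_apply, Pi.add_apply, Pi.sub_apply]
      field_simp
      ring
    · intro x hx
      have := hφ x hx
      have := hw x hx
      have := hM x hx
      have := hh x hx
      have := hp x hx
      have := hp' x hx
      have := hx.1
      have h1 := e1 x hx
      have h2 := e2 x hx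
      have h3 := e3 x hx
      apply add_nonneg
      apply add_nonneg
      · positivity
      · apply mul_nonneg
        · apply div_nonneg (mul_nonneg _ h1) <;> positivity
        · apply div_nonneg (mul_nonneg h3 _) <;> positivity
      · apply mul_nonneg _ h2
        positivity
    · intro x hx
      have q1 := hφ x hx
      have q2 := hw x hx
      have q3 := hM x hx
      have q4 := hh x hx
      have q5 := hp x hx
      have q6 := hx.1
      have h1 := e1 x hx
      have hr : h x / (M x * φ x) ≤ 1 := by
        rw [div_le_one (by positivity)]; linarith
      have hr0 : 0 ≤ h x / (M x * φ x) := by positivity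
      have hk0 : 0 ≤ (1 + a * x / (1 - x)) * h x :=
        mul_nonneg (zero_le_one.trans (hk1 x hx)) q4.le
      have hb : x * w x * h x / φ x ≤ x * w x * M x := by
        rw [div_le_iff₀ q1]
        nlinarith [mul_pos q6 q2]
      have hX : 0 ≤ x * w x * M x := by positivity
      have hph : 0 ≤ p x * h x := by positivity
      nlinarith [mul_nonneg (sub_nonneg.2 hr) (sub_nonneg.2 hb),
        mul_nonneg (sub_nonneg.2 hr) hk0, mul_nonneg hr0 hX]
    · simpa using lM.const_mul (-2)
  have hD : ∀ x ∈ Ioo (0 : ℝ) 1,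
      HasDerivAt (fun x => x * w x * M x / h x - x * w x / φ x)
        ((p x * h x - (1 - h x / (M x * φ x)) *
      (x * w x * M x + x * w x * h x / φ x - (1 + a * x / (1 - x)) * h x))
        * (w x * M x / h x ^ 2)) x := by
    intro x hx
    have h1 : (1 - x) ≠ 0 := by linarith [hx.2]
    have h0 : x ≠ 0 := hx.1.ne'
    have h2 : w x ≠ 0 := (hw x hx).ne'
    have h3 : φ x ≠ 0 := (hφ x hx).ne'
    have h4 : M x ≠ 0 := (hM x hx).ne'
    have h5 : h x ≠ 0 := (hh x hx).ne'
    have hxw := (hasDerivAt_id x).mul (hw' x hx)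
    refine HasDerivAt.congr_deriv (((hxw.mul (hM' x hx)).div (hh' x hx) h5).sub (hxw.div (hφ' x hx) h3)) ?_
    simp only [id, Pi.mul_apply, Pi.pow_apply, Pi.div_apply, Pi.add_apply, Pi.sub_apply]
    field_simp
    ring
  apply monotoneOn_of_deriv_nonneg (convex_Ioo 0 1)
  · exact fun x hx => (hD x hx).continuousAt.continuousWithinAt
  · intro x hx
    rw [interior_Ioo] at hx
    exact (hD x hx).differentiableAt.differentiableWithinAt
  · intro x hx
    rw [interior_Ioo] at hx
    rw [(hD x hx).deriv]
    apply mul_nonneg (e4 x hx)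
    have := hw x hx
    have := hM x hx
    positivity

lemma lcwm_int (α : ℝ) (hα₂ : α ≤ 0) (M : ℝ → ℝ)
    (hpos : ∀ x ∈ Ioo (0 : ℝ) 1, 0 < M x)
    (hmono : MonotoneOn M (Ioo (0 : ℝ) 1))
    (hc : ContinuousOn M (Ioo (0 : ℝ) 1)) :
    (∀ x ∈ Ioo (0 : ℝ) 1, 0 < ∫ s in (0 : ℝ)..x, M s * (1 - s) ^ α) ∧
    (∀ x ∈ Ioo (0 : ℝ) 1,
      HasDerivAt (fun x => ∫ s in (0 : ℝ)..x, M s * (1 - s) ^ α) (M x * (1 - x) ^ α) x) ∧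
    Filter.Tendsto (fun x => ∫ s in (0 : ℝ)..x, M s * (1 - s) ^ α)
      (nhdsWithin 0 (Ioi 0)) (nhds 0) := by
  have hcw : ContinuousOn (fun s => M s * (1 - s) ^ α) (Ioo (0 : ℝ) 1) := by
    apply hc.mul
    apply ContinuousOn.rpow_const (by fun_prop)
    intro x hx
    left
    linarith [hx.2]
  have hP : ∀ x ∈ Ioo (0 : ℝ) 1, 0 < M x * (1 - x) ^ α := fun x hx =>
    mul_pos (hpos x hx) (Real.rpow_pos_of_pos (by linarith [hx.2]) _)
  have hbd : ∀ x ∈ Ioo (0 : ℝ) 1, ∀ s ∈ Ioc (0 : ℝ) x,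
      ‖M s * (1 - s) ^ α‖ ≤ M x * (1 - x) ^ α := by
    intro x hx s hs
    have hs1 : s ∈ Ioo (0 : ℝ) 1 := ⟨hs.1, hs.2.trans_lt hx.2⟩
    rw [Real.norm_of_nonneg (hP s hs1).le]
    apply mul_le_mul (hmono hs1 hx hs.2) _ (Real.rpow_nonneg (by linarith [hs1.2]) _)
      (hpos x hx).le
    exact Real.rpow_le_rpow_of_nonpos (by linarith [hx.2]) (by linarith [hs.2]) hα₂
  have hint : ∀ x ∈ Ioo (0 : ℝ) 1,
      IntervalIntegrable (fun s => M s * (1 - s) ^ α) MeasureTheory.volume 0 x := by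
    intro x hx
    rw [intervalIntegrable_iff_integrableOn_Ioc_of_le hx.1.le]
    apply MeasureTheory.IntegrableOn.of_bound (by simp)
      ((hcw.mono (fun s hs => ⟨hs.1, hs.2.trans_lt hx.2⟩)).aestronglyMeasurable
        measurableSet_Ioc) (M x * (1 - x) ^ α)
    exact (MeasureTheory.ae_restrict_mem measurableSet_Ioc).mono (hbd x hx)
  refine ⟨?_, ?_, ?_⟩
  · intro x hx
    apply intervalIntegral.intervalIntegral_pos_of_pos_on (hint x hx) _ hx.1
    exact fun s hs => hP s ⟨hs.1, hs.2.trans hx.2⟩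
  · intro x hx
    apply intervalIntegral.integral_hasDerivAt_right (hint x hx)
    · exact hcw.stronglyMeasurableAtFilter isOpen_Ioo x hx
    · exact hcw.continuousAt (isOpen_Ioo.mem_nhds hx)
  · have hh : (1 / 2 : ℝ) ∈ Ioo (0 : ℝ) 1 := by constructor <;> norm_num
    apply squeeze_zero_norm' (a := fun x => M (1 / 2) * (1 - 1 / 2) ^ α * |x - 0|)
    · filter_upwards [Ioo_mem_nhdsGT hh.1] with x hx
      apply intervalIntegral.norm_integral_le_of_norm_le_const
      intro s hs
      rw [uIoc_of_le hx.1.le] at hs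
      exact hbd _ hh s ⟨hs.1, hs.2.trans hx.2.le⟩
    · have : Continuous (fun x : ℝ => M (1 / 2) * (1 - 1 / 2) ^ α * |x - 0|) := by fun_prop
      have h2 := this.tendsto 0
      simp only [sub_zero, abs_zero, mul_zero] at h2
      simpa using h2.mono_left nhdsWithin_le_nhds

/-- If `-2 ≤ α ≤ 0` and `M` is a positive, non-decreasing, twice differentiable
function on `(0,1)` such that `log M(x)` is convex in `log x`, then
`x ↦ log ((∫₀ˣ M(t)(1-t)^α dt) / (∫₀ˣ (1-t)^α dt))` is convex in `log x`. -/
theorem log_convex_weighted_mean (α : ℝ) (hα₁ : -2 ≤ α) (hα₂ : α ≤ 0) (M : ℝ → ℝ)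
    (hpos : ∀ x ∈ Ioo (0 : ℝ) 1, 0 < M x)
    (hmono : MonotoneOn M (Ioo (0 : ℝ) 1))
    (hd1 : ∀ x ∈ Ioo (0 : ℝ) 1, DifferentiableAt ℝ M x)
    (hd2 : ∀ x ∈ Ioo (0 : ℝ) 1, DifferentiableAt ℝ (deriv M) x)
    (hconv : ConvexOn ℝ (Iio (0 : ℝ)) (fun t : ℝ => Real.log (M (Real.exp t)))) :
    ConvexOn ℝ (Iio (0 : ℝ)) (fun t : ℝ =>
      Real.log ((∫ s in (0 : ℝ)..(Real.exp t), M s * (1 - s) ^ α) /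
        (∫ s in (0 : ℝ)..(Real.exp t), (1 - s) ^ α))) := by
  obtain ⟨hh, hh', lh⟩ := lcwm_int α hα₂ M hpos hmono
    (fun x hx => (hd1 x hx).continuousAt.continuousWithinAt)
  obtain ⟨hφ, hφ', lφ⟩ := lcwm_int α hα₂ (fun _ => 1) (fun _ _ => one_pos)
    (fun _ _ _ _ _ => le_rfl) continuousOn_const
  simp only [one_mul] at hφ hφ' lφ
  have hexp : ∀ t ∈ Iio (0 : ℝ), Real.exp t ∈ Ioo (0 : ℝ) 1 := fun t ht =>
    ⟨Real.exp_pos t, by rw [Real.exp_lt_one_iff]; exact ht⟩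
  set h : ℝ → ℝ := fun x => ∫ s in (0 : ℝ)..x, M s * (1 - s) ^ α with hdef
  set φ : ℝ → ℝ := fun x => ∫ s in (0 : ℝ)..x, (1 - s) ^ α with φdef
  set w : ℝ → ℝ := fun x => (1 - x) ^ α with wdef
  set p : ℝ → ℝ := fun x => x * deriv M x / M x with pdef
  have hw : ∀ x ∈ Ioo (0 : ℝ) 1, 0 < w x := fun x hx =>
    Real.rpow_pos_of_pos (by linarith [hx.2]) _
  have hw' : ∀ x ∈ Ioo (0 : ℝ) 1, HasDerivAt w (-α * w x / (1 - x)) x := by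
    intro x hx
    have h1 : 0 < 1 - x := by linarith [hx.2]
    have := ((hasDerivAt_id x).const_sub 1).rpow_const (p := α) (Or.inl h1.ne')
    refine HasDerivAt.congr_deriv (this) ?_
    simp only [wdef, id]
    rw [Real.rpow_sub_one h1.ne']
    field_simp
  have wcont : Filter.Tendsto w (nhdsWithin 0 (Ioi 0)) (nhds 1) := by
    have : ContinuousAt w 0 := by
      apply ContinuousAt.rpow_const (by fun_prop)
      left; norm_num
    have h2 := this.tendsto
    simp only [wdef, sub_zero, Real.one_rpow] at h2
    exact h2.mono_left nhdsWithin_le_nhds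
  have lx : Filter.Tendsto (fun x : ℝ => x) (nhdsWithin 0 (Ioi 0)) (nhds 0) :=
    Filter.tendsto_id.mono_left nhdsWithin_le_nhds
  have lw : Filter.Tendsto (fun x => x * w x) (nhdsWithin 0 (Ioi 0)) (nhds 0) := by
    simpa using lx.mul wcont
  have hhalf : (1 / 2 : ℝ) ∈ Ioo (0 : ℝ) 1 := by constructor <;> norm_num
  have lM : Filter.Tendsto (fun x => x * w x * M x) (nhdsWithin 0 (Ioi 0)) (nhds 0) := by
    apply squeeze_zero' (g := fun x => x * w x * M (1 / 2))
    · filter_upwards [Ioo_mem_nhdsGT hhalf.1] with x hx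
      have hx1 : x ∈ Ioo (0 : ℝ) 1 := ⟨hx.1, hx.2.trans hhalf.2⟩
      exact (mul_pos (mul_pos hx.1 (hw x hx1)) (hpos x hx1)).le
    · filter_upwards [Ioo_mem_nhdsGT hhalf.1] with x hx
      have hx1 : x ∈ Ioo (0 : ℝ) 1 := ⟨hx.1, hx.2.trans hhalf.2⟩
      exact mul_le_mul_of_nonneg_left (hmono hx1 hhalf hx.2.le) (mul_pos hx.1 (hw x hx1)).le
    · simpa using lw.mul_const (M (1 / 2))
  have hMder : ∀ x ∈ Ioo (0 : ℝ) 1, 0 ≤ deriv M x := by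
    intro x hx
    rw [← derivWithin_of_isOpen isOpen_Ioo hx]
    exact hmono.derivWithin_nonneg
  have hp : ∀ x ∈ Ioo (0 : ℝ) 1, 0 ≤ p x := fun x hx =>
    div_nonneg (mul_nonneg hx.1.le (hMder x hx)) (hpos x hx).le
  have hM' : ∀ x ∈ Ioo (0 : ℝ) 1, HasDerivAt M (p x * M x / x) x := by
    intro x hx
    refine HasDerivAt.congr_deriv ((hd1 x hx).hasDerivAt) ?_
    have h0 : x ≠ 0 := hx.1.ne'
    have h4 : M x ≠ 0 := (hpos x hx).ne'
    simp only [pdef]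
    field_simp
  have hpd : ∀ x ∈ Ioo (0 : ℝ) 1, HasDerivAt p (deriv p x) x := by
    intro x hx
    apply DifferentiableAt.hasDerivAt
    exact (differentiableAt_id.mul (hd2 x hx)).div (hd1 x hx) (hpos x hx).ne'
  have hLd : ∀ t ∈ Iio (0 : ℝ),
      HasDerivAt (fun t : ℝ => Real.log (M (Real.exp t))) (p (Real.exp t)) t := by
    intro t ht
    have h1 := ((hd1 _ (hexp t ht)).hasDerivAt.comp t (Real.hasDerivAt_exp t)).log
      (hpos _ (hexp t ht)).ne'
    refine HasDerivAt.congr_deriv (h1) ?_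
    simp only [pdef, Function.comp]
    ring
  have hpm : MonotoneOn p (Ioo (0 : ℝ) 1) := by
    intro x hx y hy hxy
    have h1 := hconv.monotoneOn_deriv (fun t ht => (hLd t ht).differentiableAt)
    have hx' : Real.log x ∈ Iio (0 : ℝ) := Real.log_neg hx.1 hx.2
    have hy' : Real.log y ∈ Iio (0 : ℝ) := Real.log_neg hy.1 hy.2
    have h2 := h1 hx' hy' (Real.log_le_log hx.1 hxy)
    rw [(hLd _ hx').deriv, (hLd _ hy').deriv, Real.exp_log hx.1, Real.exp_log hy.1] at h2
    exact h2
  have hp' : ∀ x ∈ Ioo (0 : ℝ) 1, 0 ≤ deriv p x := by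
    intro x hx
    rw [← derivWithin_of_isOpen isOpen_Ioo hx]
    exact hpm.derivWithin_nonneg
  have key := lcwm_core (-α) (by linarith) (by linarith) w φ h M p (deriv p) hw hw' hφ hφ'
    hh hh' hpos hM' hp hpd hp' lφ lh lw lM
  have hF : ∀ t ∈ Iio (0 : ℝ), HasDerivAt (fun t : ℝ => Real.log (h (Real.exp t) / φ (Real.exp t)))
      ((fun x => x * w x * M x / h x - x * w x / φ x) (Real.exp t)) t := by
    intro t ht
    have hx := hexp t ht
    have h3 : φ (Real.exp t) ≠ 0 := (hφ _ hx).ne'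
    have h5 : h (Real.exp t) ≠ 0 := (hh _ hx).ne'
    have a1 := (hh' _ hx).comp t (Real.hasDerivAt_exp t)
    have a2 := (hφ' _ hx).comp t (Real.hasDerivAt_exp t)
    have a3 := (a1.div a2 h3).log (div_ne_zero h5 h3)
    refine HasDerivAt.congr_deriv (a3) ?_
    simp only [Function.comp, Pi.div_apply, wdef]
    change _ / (h (Real.exp t) / φ (Real.exp t)) = _
    field_simp
  change ConvexOn ℝ (Iio (0 : ℝ)) (fun t : ℝ => Real.log (h (Real.exp t) / φ (Real.exp t)))
  apply MonotoneOn.convexOn_of_deriv (convex_Iio 0)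
  · exact fun x hx => (hF x hx).continuousAt.continuousWithinAt
  · intro x hx
    rw [interior_Iio] at hx
    exact (hF x hx).differentiableAt.differentiableWithinAt
  · rw [interior_Iio]
    intro s hs t ht hst
    rw [(hF s hs).deriv, (hF t ht).deriv]
    exact key (hexp s hs) (hexp t ht) (Real.exp_le_exp.2 hst)
end

section
/- Let −2 ≤ α ≤ 0 and x ∈ [0,1). Then x·( φ(x)² − (1 + x + αx)φ(x) + x )² ≥ (1 − (α+1)φ(x))·(φ(x) − x)³. -/
open Real Set

/-- `φ(x) = ∫₀ˣ (1-t)^α dt`. -/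
noncomputable def phi (α : ℝ) (x : ℝ) : ℝ := ∫ t in (0 : ℝ)..x, (1 - t) ^ α

lemma phi_aux_integrable (α x : ℝ) (hx0 : 0 ≤ x) (hx1 : x < 1) :
    IntervalIntegrable (fun t : ℝ => (1 - t) ^ α) MeasureTheory.volume 0 x := by
  apply ContinuousOn.intervalIntegrable
  rw [uIcc_of_le hx0]
  apply ContinuousOn.rpow_const (by fun_prop)
  intro t ht
  left
  have := ht.2
  linarith

lemma phi_ge (α x : ℝ) (hα : α ≤ 0) (hx0 : 0 ≤ x) (hx1 : x < 1) : x ≤ phi α x := by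
  have h : ∫ t in (0 : ℝ)..x, (1 : ℝ) ≤ phi α x := by
    apply intervalIntegral.integral_mono_on hx0 (by simp) (phi_aux_integrable α x hx0 hx1)
    intro t ht
    exact Real.one_le_rpow_of_pos_of_le_one_of_nonpos (by linarith [ht.2]) (by linarith [ht.1]) hα
  simpa using h

lemma phi_le (α x : ℝ) (h1 : -2 ≤ α) (h2 : α ≤ 0) (hx0 : 0 ≤ x) (hx1 : x < 1) :
    phi α x ≤ x * (1 - (α + 2) / 2 * x) / (1 - x) := by
  set b := (α + 2) / 2 with hb
  have hd : ∀ t ∈ uIcc 0 x, HasDerivAt (fun t : ℝ => t * (1 - b * t) / (1 - t))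
      ((1 - 2 * b * t + b * t ^ 2) / (1 - t) ^ 2) t := by
    intro t ht
    rw [uIcc_of_le hx0] at ht
    have hne : 1 - t ≠ 0 := by linarith [ht.2]
    have e1 : HasDerivAt (fun t : ℝ => t * (1 - b * t)) (1 * (1 - b * t) + t * (-(b * 1))) t :=
      (hasDerivAt_id t).mul (((hasDerivAt_id t).const_mul b).const_sub 1)
    have e2 : HasDerivAt (fun t : ℝ => 1 - t) (-1) t := (hasDerivAt_id t).const_sub 1
    refine (e1.div e2 hne).congr_deriv ?_
    congr 1
    ring
  have hi : IntervalIntegrable (fun t : ℝ => (1 - 2 * b * t + b * t ^ 2) / (1 - t) ^ 2)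
      MeasureTheory.volume 0 x := by
    apply ContinuousOn.intervalIntegrable
    rw [uIcc_of_le hx0]
    apply ContinuousOn.div (by fun_prop) (by fun_prop)
    intro t ht
    have : 0 < 1 - t := by linarith [ht.2]
    positivity
  have h := intervalIntegral.integral_eq_sub_of_hasDerivAt hd hi
  have hm : phi α x ≤ ∫ t in (0 : ℝ)..x, (1 - 2 * b * t + b * t ^ 2) / (1 - t) ^ 2 := by
    apply intervalIntegral.integral_mono_on hx0 (phi_aux_integrable α x hx0 hx1) hi
    intro t ht
    have hp : 0 < 1 - t := by linarith [ht.2]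
    rw [le_div_iff₀ (by positivity), ← Real.rpow_natCast (1 - t) 2, ← Real.rpow_add hp]
    have e : α + ((2 : ℕ) : ℝ) = ((2 : ℕ) : ℝ) * b := by rw [hb]; push_cast; ring
    rw [e, Real.rpow_mul hp.le, Real.rpow_natCast]
    have hB := rpow_one_add_le_one_add_mul_self (s := (1 - t) ^ 2 - 1) (p := b)
      (by nlinarith [sq_nonneg (1 - t)]) (by rw [hb]; linarith) (by rw [hb]; linarith)
    have e3 : 1 + ((1 - t) ^ 2 - 1) = (1 - t) ^ 2 := by ring
    rw [e3] at hB
    refine hB.trans (le_of_eq ?_)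
    ring
  rw [h] at hm
  simpa using hm

/-- The quadratic inequality for `y = x / φ(x)`, with `p = 1 - x`, `q = -α x / 2`. -/
lemma quad_aux (p q y : ℝ) (hp : 0 < p) (hq : 0 ≤ q) (hpq : p + q ≤ 1)
    (hy : p ≤ y * (p + q)) :
    0 ≤ 2 * y ^ 2 - (4 - 3 * p - 6 * q) * y + (2 - 3 * p - 2 * q) := by
  have hs : 0 < p + q := by linarith
  rcases le_total (4 * p) ((4 - 3 * p - 6 * q) * (p + q)) with h | h
  · have h1 : (p + 2 * q) * (3 * (p + q)) ≤ 4 * q := by nlinarith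
    have h2 : 9 / 8 * (p + 2 * q) ^ 2 ≤ 4 * q := by nlinarith
    nlinarith [sq_nonneg (y - (4 - 3 * p - 6 * q) / 4)]
  · obtain ⟨t, ht⟩ : ∃ t, t = p / (p + q) := ⟨_, rfl⟩
    have htp : t * (p + q) = p := by rw [ht]; field_simp
    have hty : t ≤ y := by
      by_contra hc
      push Not at hc
      nlinarith
    have htv : 4 - 3 * p - 6 * q ≤ 4 * t := by
      rw [← htp, ← mul_assoc] at h
      have : (4 - 3 * p - 6 * q) * (p + q) ≤ 4 * t * (p + q) := by
        rw [mul_assoc, htp]; rw [mul_assoc, htp] at h; linarith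
      exact le_of_mul_le_mul_right this hs
    have e : (2 * t ^ 2 - (4 - 3 * p - 6 * q) * t + (2 - 3 * p - 2 * q)) * (p + q) ^ 2
        = q * (2 * q + (p + q) * (p - 2 * q)) := by
      have : (2 * t ^ 2 - (4 - 3 * p - 6 * q) * t + (2 - 3 * p - 2 * q)) * (p + q) ^ 2
        = 2 * (t * (p + q)) ^ 2 - (4 - 3 * p - 6 * q) * (t * (p + q)) * (p + q)
          + (2 - 3 * p - 2 * q) * (p + q) ^ 2 := by ring
      rw [this, htp]; ring
    have hr : 0 ≤ 2 * q + (p + q) * (p - 2 * q) := by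
      rcases le_total (2 * q) p with h3 | h3
      · have := mul_nonneg hs.le (sub_nonneg.2 h3); linarith
      · nlinarith
    have hQ : 0 ≤ 2 * t ^ 2 - (4 - 3 * p - 6 * q) * t + (2 - 3 * p - 2 * q) := by
      have : 0 ≤ (2 * t ^ 2 - (4 - 3 * p - 6 * q) * t + (2 - 3 * p - 2 * q)) * (p + q) ^ 2 := by
        rw [e]; exact mul_nonneg hq hr
      exact nonneg_of_mul_nonneg_left this (by positivity)
    nlinarith [mul_nonneg (sub_nonneg.2 hty) (sub_nonneg.2 htv), sq_nonneg (y - t)]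

/-- For `-2 ≤ α ≤ 0` and `x ∈ [0,1)`,
`x(φ(x)² - (1 + x + αx)φ(x) + x)² ≥ (1 - (α+1)φ(x))(φ(x) - x)³`. -/
theorem key_inequality (α : ℝ) (hα₁ : -2 ≤ α) (hα₂ : α ≤ 0)
    (x : ℝ) (hx : x ∈ Ico (0 : ℝ) 1) :
    (1 - (α + 1) * phi α x) * (phi α x - x) ^ 3 ≤
      x * ((phi α x) ^ 2 - (1 + x + α * x) * phi α x + x) ^ 2 := by
  obtain ⟨hx0, hx1⟩ := hx
  rcases hx0.eq_or_lt with h0 | h0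
  · subst h0
    simp [phi]
  have hge := phi_ge α x hα₂ hx0 hx1
  have hle := phi_le α x hα₁ hα₂ hx0 hx1
  generalize phi α x = f at *
  have hf : 0 < f := by linarith
  have hp : 0 < 1 - x := by linarith
  rw [le_div_iff₀ hp] at hle
  obtain ⟨y, hy⟩ : ∃ y, y = x / f := ⟨_, rfl⟩
  have hyf : y * f = x := by rw [hy]; field_simp
  have hQ := quad_aux (1 - x) (-α * x / 2) y hp (by nlinarith) (by nlinarith) (by
    have : f * (1 - x) ≤ f * (y * (1 - x + -α * x / 2)) := by
      calc f * (1 - x) ≤ _ := hle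
        _ = (y * f) * (1 - x + -α * x / 2) := by rw [hyf]; ring
        _ = _ := by ring
    exact le_of_mul_le_mul_left this hf)
  have hQ2 : 0 ≤ (3 * x + α * x - 1) * f ^ 2 - x * (1 + 3 * (α + 1) * x) * f + 2 * x ^ 2 := by
    have := mul_nonneg hQ (sq_nonneg f)
    refine this.trans (le_of_eq ?_)
    have e : ∀ z : ℝ, (2 * y ^ 2 - (4 - 3 * (1 - x) - 6 * z) * y + (2 - 3 * (1 - x) - 2 * z)) * f ^ 2
      = 2 * (y * f) ^ 2 - (4 - 3 * (1 - x) - 6 * z) * (y * f) * f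
        + (2 - 3 * (1 - x) - 2 * z) * f ^ 2 := fun z => by ring
    rw [e, hyf]; ring
  obtain ⟨D, hD⟩ : ∃ D, D = f - x := ⟨_, rfl⟩
  obtain ⟨w, hw⟩ : ∃ w, w = 1 - (α + 1) * f := ⟨_, rfl⟩
  obtain ⟨B, hB⟩ : ∃ B, B = f ^ 2 - (1 + x + α * x) * f + x := ⟨_, rfl⟩
  have hD0 : 0 ≤ D := by linarith
  rw [← hD, ← hw, ← hB]
  have hk : D * (x * w + D) ≤ 2 * x * B := by
    rw [hD, hw, hB]; nlinarith
  rcases le_total w 0 with hw0 | hw0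
  · have : w * D ^ 3 ≤ 0 := mul_nonpos_of_nonpos_of_nonneg hw0 (by positivity)
    exact this.trans (by positivity)
  · have h1 : (D * (x * w + D)) ^ 2 ≤ (2 * x * B) ^ 2 :=
      pow_le_pow_left₀ (by positivity) hk 2
    have h2 : 0 ≤ (D * (x * w - D)) ^ 2 := sq_nonneg _
    have h3 : (4 * x) * (w * D ^ 3) ≤ (4 * x) * (x * B ^ 2) := by nlinarith
    exact le_of_mul_le_mul_left h3 (by positivity)
end
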